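/- arXiv:2501.17254 — 2 statements merged into one kernel-verified Lean document; each statement's English description precedes it below -/
import Mathlib

section
/- (Theorem 1(i).) Let n ≥ 1, 1 < p < ∞, and let F be a finite-dimensional real inner product space. There exists a constant C = C(n,p) > 0 such that for every connection form Γ ∈ C¹ on the closed half-space ℝⁿ × [0,∞) ⊆ ℝ^{n+1} with values in L(ℝ^{n+1}, o(F)), every β > 0 with ‖K_Γ‖_∞ ≤ β, and every C¹ map U : ℝⁿ × [0,∞) → F with compact support: (∬_{ℝⁿ×ℝⁿ} ‖U(x,0) − R^{Γ∥}(x,y) U(y,0)‖^p / |x−y|^{n+p−1} dx dy)^{1/p} + β^{(p−1)/(2p)} (∫_{ℝⁿ} ‖U(x,0)‖^p dx)^{1/p} ≤ C ((∫_{ℝⁿ×(0,∞)} ‖D_Γ U‖^p)^{1/p} + β^{1/2} (∫_{ℝⁿ×(0,∞)} ‖U‖^p)^{1/p}), where ‖D_Γ U(z)‖ is the Hilbert–Schmidt norm of D_Γ U(z) ∈ L(ℝ^{n+1}, F). -/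
set_option synthInstance.maxHeartbeats 1000000
set_option maxHeartbeats 1000000

open Set MeasureTheory
open scoped RealInnerProductSpace ENNReal

/-- The point `(x, t) ∈ ℝⁿ × ℝ ≅ ℝ^{n+1}`. -/
noncomputable def emb {n : ℕ} (x : EuclideanSpace ℝ (Fin n)) (t : ℝ) :
    EuclideanSpace ℝ (Fin (n + 1)) :=
  (EuclideanSpace.equiv (Fin (n + 1)) ℝ).symm
    (Fin.snoc ((EuclideanSpace.equiv (Fin n) ℝ) x) t)

/-- The Hilbert–Schmidt (Frobenius) norm of a continuous linear map from `ℝ^m` to `F`. -/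
noncomputable def hsNorm {m : ℕ} {F : Type*} [NormedAddCommGroup F] [InnerProductSpace ℝ F]
    (T : EuclideanSpace ℝ (Fin m) →L[ℝ] F) : ℝ :=
  Real.sqrt (∑ i : Fin m, ‖T (EuclideanSpace.single i (1 : ℝ))‖ ^ 2)

/-- The closed upper half-space `ℝⁿ × [0,∞) ⊆ ℝ^{n+1}`. -/
def closedHalfSpace (n : ℕ) : Set (EuclideanSpace ℝ (Fin (n + 1))) :=
  {z | 0 ≤ z (Fin.last n)}


section ODE
variable {F : Type*} [NormedAddCommGroup F] [InnerProductSpace ℝ F]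

lemma skew_norm_le {a b : ℝ} (hab : a ≤ b) {w g : ℝ → F} {A : ℝ → F →L[ℝ] F} {m : ℝ → ℝ}
    (hskew : ∀ s ∈ Icc a b, ⟪A s (w s), w s⟫ = 0)
    (hw : ∀ s ∈ Icc a b, HasDerivWithinAt w (-(A s (w s)) + g s) (Icc a b) s)
    (hm : Continuous m) (hg : ∀ s ∈ Icc a b, ‖g s‖ ≤ m s) :
    ‖w b‖ ≤ ‖w a‖ + ∫ s in a..b, m s := by
  have key : ∀ η : ℝ, 0 < η → ‖w b‖ ≤ ‖w a‖ + η + ∫ s in a..b, m s := by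
    intro η hη
    have hpos : ∀ s, 0 < ‖w s‖ ^ 2 + η ^ 2 := fun s => by positivity
    have hd : ∀ s ∈ Icc a b, HasDerivWithinAt (fun s => Real.sqrt (‖w s‖ ^ 2 + η ^ 2))
        (2 * ⟪w s, -(A s (w s)) + g s⟫ / (2 * Real.sqrt (‖w s‖ ^ 2 + η ^ 2))) (Icc a b) s := by
      intro s hs
      exact ((hw s hs).norm_sq.add_const _).sqrt (hpos s).ne'
    have h1 := image_le_of_deriv_right_le_deriv_boundary
      (f := fun s => Real.sqrt (‖w s‖ ^ 2 + η ^ 2))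
      (f' := fun s => 2 * ⟪w s, -(A s (w s)) + g s⟫ / (2 * Real.sqrt (‖w s‖ ^ 2 + η ^ 2)))
      (a := a) (b := b) (fun s hs => (hd s hs).continuousWithinAt)
      (fun s hs => (hd s ⟨hs.1, hs.2.le⟩).mono_of_mem_nhdsWithin
        (Icc_mem_nhdsGE_of_mem hs))
      (B := fun s => Real.sqrt (‖w a‖ ^ 2 + η ^ 2) + ∫ x in a..s, m x)
      (B' := m) (by simp)
      (by
        apply Continuous.continuousOn
        exact continuous_const.add (intervalIntegral.continuous_primitive
          (fun _ _ => hm.intervalIntegrable _ _) _))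
      (fun s hs => by
        apply HasDerivAt.hasDerivWithinAt
        apply HasDerivAt.const_add
        exact intervalIntegral.integral_hasDerivAt_right (hm.intervalIntegrable _ _)
          hm.stronglyMeasurable.stronglyMeasurableAtFilter hm.continuousAt)
      (fun s hs => by
        have hs' : s ∈ Icc a b := ⟨hs.1, hs.2.le⟩
        have e1 : ⟪w s, -(A s (w s)) + g s⟫ = ⟪w s, g s⟫ := by
          rw [inner_add_right, inner_neg_right, real_inner_comm, hskew s hs']; simp
        have hS := Real.sqrt_pos.mpr (hpos s)
        rw [e1, mul_div_mul_left _ _ two_ne_zero, div_le_iff₀ hS]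
        have e2 : ‖w s‖ ≤ Real.sqrt (‖w s‖ ^ 2 + η ^ 2) :=
          Real.le_sqrt_of_sq_le (by nlinarith)
        calc ⟪w s, g s⟫ ≤ ‖w s‖ * ‖g s‖ := real_inner_le_norm _ _
          _ ≤ Real.sqrt (‖w s‖ ^ 2 + η ^ 2) * m s := by
            gcongr
            exact hg s hs'
          _ = _ := mul_comm _ _)
    have h2 := h1 (right_mem_Icc.mpr hab)
    have e2 : ‖w b‖ ≤ Real.sqrt (‖w b‖ ^ 2 + η ^ 2) := Real.le_sqrt_of_sq_le (by nlinarith)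
    have e3 : Real.sqrt (‖w a‖ ^ 2 + η ^ 2) ≤ ‖w a‖ + η := by
      rw [Real.sqrt_le_left (by positivity)]
      nlinarith [norm_nonneg (w a)]
    linarith
  apply le_of_forall_pos_le_add
  intro η hη
  have := key η hη
  linarith

lemma skew_norm_le_const {a b : ℝ} (hab : a ≤ b) {w g : ℝ → F} {A : ℝ → F →L[ℝ] F} {m : ℝ}
    (hskew : ∀ s ∈ Icc a b, ⟪A s (w s), w s⟫ = 0)
    (hw : ∀ s ∈ Icc a b, HasDerivWithinAt w (-(A s (w s)) + g s) (Icc a b) s)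
    (hg : ∀ s ∈ Icc a b, ‖g s‖ ≤ m) :
    ‖w b‖ ≤ ‖w a‖ + (b - a) * m := by
  have := skew_norm_le hab hskew hw (m := fun _ => m) continuous_const hg
  simpa using this

lemma skew_norm_parallel {u : ℝ → F} {A : ℝ → F →L[ℝ] F}
    (hskew : ∀ s ∈ Icc (0:ℝ) 1, ∀ v, ⟪A s v, v⟫ = 0)
    (hu : ∀ s ∈ Icc (0:ℝ) 1, HasDerivWithinAt u (-(A s (u s))) (Icc (0:ℝ) 1) s) :
    ∀ s ∈ Icc (0:ℝ) 1, ‖u s‖ ≤ ‖u 0‖ := by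
  intro s hs
  have := skew_norm_le_const (a := 0) (b := s) hs.1 (w := u) (g := fun _ => 0) (A := A) (m := 0)
    (fun r hr => hskew r ⟨hr.1, hr.2.trans hs.2⟩ _)
    (fun r hr => by
      simpa using (hu r ⟨hr.1, hr.2.trans hs.2⟩).mono (Icc_subset_Icc_right hs.2)) (by simp)
  simpa using this

lemma exists_parallel [FiniteDimensional ℝ F] {A : ℝ → F →L[ℝ] F}
    (hA : ContinuousOn A (Icc 0 1))
    (hskew : ∀ s ∈ Icc (0:ℝ) 1, ∀ v, ⟪A s v, v⟫ = 0) (u0 : F) :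
    ∃ u : ℝ → F, u 0 = u0 ∧
      ∀ s ∈ Icc (0:ℝ) 1, HasDerivWithinAt u (-(A s (u s))) (Icc (0:ℝ) 1) s := by
  obtain ⟨M, hM⟩ := isCompact_Icc.exists_bound_of_continuousOn hA
  let φ : ContDiffBump (0 : F) := ⟨‖u0‖ + 1, ‖u0‖ + 2, by positivity, by linarith⟩
  have hcs : HasCompactSupport (fun v : F => φ v • v) := φ.hasCompactSupport.smul_right
  have hcd : ContDiff ℝ 1 (fun v : F => φ v • v) := φ.contDiff.smul contDiff_id
  obtain ⟨K, hK⟩ := hcd.lipschitzWith_of_hasCompactSupport hcs (by simp)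
  obtain ⟨R, hR⟩ := hcs.exists_bound_of_continuous hcd.continuous
  set M' : NNReal := ‖M‖₊ with hM'
  set R' : NNReal := ‖R‖₊
  have hMM : ∀ s ∈ Icc (0:ℝ) 1, ‖A s‖ ≤ M' := fun s hs => (hM s hs).trans (le_abs_self M)
  have hRR : ∀ v, ‖φ v • v‖ ≤ R' := fun v => (hR v).trans (le_abs_self R)
  have hPL : IsPicardLindelof (fun s v => -(A s (φ v • v))) (tmin := 0) (tmax := 1)
      ⟨0, by simp⟩ u0 (M' * R') 0 (M' * R') (M' * K) := by
    refine ⟨?_, ?_, ?_, ?_⟩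
    · intro t ht
      apply LipschitzWith.lipschitzOnWith
      apply LipschitzWith.of_dist_le_mul
      intro x y
      rw [dist_neg_neg, dist_eq_norm, ← map_sub]
      have h1 := hK.dist_le_mul x y
      rw [dist_eq_norm] at h1
      calc _ ≤ ‖A t‖ * ‖φ x • x - φ y • y‖ := (A t).le_opNorm _
        _ ≤ M' * (K * dist x y) := by
          gcongr
          exact hMM t ht
        _ = _ := by push_cast; ring
    · intro x _
      exact (hA.clm_apply continuousOn_const).neg
    · intro t ht x _
      rw [norm_neg]
      calc _ ≤ ‖A t‖ * ‖φ x • x‖ := (A t).le_opNorm _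
        _ ≤ M' * R' := by
          gcongr
          exacts [hMM t ht, hRR x]
        _ = _ := by push_cast; ring
    · simp
  obtain ⟨u, hu0, hu⟩ := hPL.exists_eq_forall_mem_Icc_hasDerivWithinAt₀
  refine ⟨u, hu0, ?_⟩
  have hn := skew_norm_parallel (u := u) (A := fun s => φ (u s) • A s)
    (fun s hs v => by simp [inner_smul_left, hskew s hs v])
    (fun s hs => by simpa using hu s hs)
  intro s hs
  have h1 : φ (u s) = 1 := by
    apply φ.one_of_mem_closedBall
    rw [mem_closedBall_zero_iff]
    have := hn s hs
    simp only [hu0] at this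
    change _ ≤ ‖u0‖ + 1
    linarith
  simpa [h1] using hu s hs

end ODE



section Hol
variable {F : Type*} [NormedAddCommGroup F] [InnerProductSpace ℝ F]

lemma unif_aux {V : Type*} [NormedAddCommGroup V] {f : ℝ → ℝ → V}
    (hf : ContinuousOn (Function.uncurry f) (Icc (0:ℝ) 1 ×ˢ Icc (0:ℝ) 1)) {ε : ℝ} (hε : 0 < ε) :
    ∃ η > 0, ∀ s ∈ Icc (0:ℝ) 1, ∀ t ∈ Icc (0:ℝ) 1, ∀ t' ∈ Icc (0:ℝ) 1, |t' - t| < η →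
      ‖f s t' - f s t‖ ≤ ε := by
  have hu := (isCompact_Icc.prod isCompact_Icc).uniformContinuousOn_of_continuous hf
  obtain ⟨η, hη, h⟩ := Metric.uniformContinuousOn_iff.mp hu ε hε
  refine ⟨η, hη, fun s hs t ht t' ht' htt => ?_⟩
  have := h (s, t') ⟨hs, ht'⟩ (s, t) ⟨hs, ht⟩ (by
    rw [Prod.dist_eq]; simp [Real.dist_eq, htt])
  rw [dist_eq_norm] at this
  exact this.le

lemma taylor_aux {V : Type*} [NormedAddCommGroup V] [NormedSpace ℝ V] {f f' : ℝ → ℝ → V}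
    (hd : ∀ s ∈ Icc (0:ℝ) 1, ∀ t ∈ Icc (0:ℝ) 1,
      HasDerivWithinAt (fun t => f s t) (f' s t) (Icc 0 1) t)
    (hf : ContinuousOn (Function.uncurry f') (Icc (0:ℝ) 1 ×ˢ Icc (0:ℝ) 1)) {ε : ℝ} (hε : 0 < ε) :
    ∃ η > 0, ∀ s ∈ Icc (0:ℝ) 1, ∀ t ∈ Icc (0:ℝ) 1, ∀ t' ∈ Icc (0:ℝ) 1, |t' - t| < η →
      ‖f s t' - f s t - (t' - t) • f' s t‖ ≤ ε * |t' - t| := by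
  obtain ⟨η, hη, h⟩ := unif_aux hf hε
  refine ⟨η, hη, fun s hs t ht t' ht' htt => ?_⟩
  have hsub : uIcc t t' ⊆ Icc 0 1 := (convex_Icc (0:ℝ) 1).ordConnected.uIcc_subset ht ht'
  have := (convex_uIcc t t').norm_image_sub_le_of_norm_hasDerivWithin_le
    (f := fun τ => f s τ - (τ - t) • f' s t) (f' := fun τ => f' s τ - f' s t) (C := ε)
    (fun τ hτ => by
      have h1 := (hd s hs τ (hsub hτ)).mono hsub
      have h2 := (((hasDerivWithinAt_id τ (uIcc t t')).sub_const t).smul_const (f' s t))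
      exact (h1.sub h2).congr_deriv (by simp))
    (fun τ hτ => h s hs t ht τ (hsub hτ)
      (lt_of_le_of_lt (abs_sub_left_of_mem_uIcc hτ) htt))
    (left_mem_uIcc) (right_mem_uIcc)
  have e : f s t' - (t' - t) • f' s t - (f s t - (t - t) • f' s t)
      = f s t' - f s t - (t' - t) • f' s t := by
    simp; abel
  rw [e] at this
  simpa [Real.norm_eq_abs] using this

lemma hol_step {A B At Bs : ℝ → ℝ → F →L[ℝ] F} {κ N : ℝ} {u : ℝ → ℝ → F} (hN : 0 ≤ N)
    (hAskew : ∀ s ∈ Icc (0:ℝ) 1, ∀ t ∈ Icc (0:ℝ) 1, ∀ v, ⟪A s t v, v⟫ = 0)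
    (hAt : ∀ s ∈ Icc (0:ℝ) 1, ∀ t ∈ Icc (0:ℝ) 1,
      HasDerivWithinAt (fun t => A s t) (At s t) (Icc 0 1) t)
    (hBs : ∀ s ∈ Icc (0:ℝ) 1, ∀ t ∈ Icc (0:ℝ) 1,
      HasDerivWithinAt (fun s => B s t) (Bs s t) (Icc 0 1) s)
    (hAc : ContinuousOn (Function.uncurry A) (Icc (0:ℝ) 1 ×ˢ Icc (0:ℝ) 1))
    (hBc : ContinuousOn (Function.uncurry B) (Icc (0:ℝ) 1 ×ˢ Icc (0:ℝ) 1))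
    (hAtc : ContinuousOn (Function.uncurry At) (Icc (0:ℝ) 1 ×ˢ Icc (0:ℝ) 1))
    (hB0 : ∀ t ∈ Icc (0:ℝ) 1, B 0 t = 0)
    (hK : ∀ s ∈ Icc (0:ℝ) 1, ∀ t ∈ Icc (0:ℝ) 1,
      ‖Bs s t - At s t + (A s t).comp (B s t) - (B s t).comp (A s t)‖ ≤ κ)
    (hu : ∀ t ∈ Icc (0:ℝ) 1, ∀ s ∈ Icc (0:ℝ) 1,
      HasDerivWithinAt (u t) (-(A s t (u t s))) (Icc (0:ℝ) 1) s)
    (hu0 : ∀ t ∈ Icc (0:ℝ) 1, ‖u t 0‖ ≤ N)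
    (hu00 : ∀ t ∈ Icc (0:ℝ) 1, ∀ t' ∈ Icc (0:ℝ) 1, u t 0 = u t' 0) {ε : ℝ} (hε : 0 < ε) :
    ∃ η > 0, ∀ t ∈ Icc (0:ℝ) 1, ∀ t' ∈ Icc (0:ℝ) 1, |t' - t| < η →
      ‖u t' 1 - u t 1 + (t' - t) • B 1 t (u t 1)‖ ≤ (κ * N + ε) * |t' - t| := by
  obtain ⟨M, hM⟩ := (isCompact_Icc.prod isCompact_Icc).exists_bound_of_continuousOn hBc
  have hM0 : 0 ≤ M := (norm_nonneg _).trans (hM (0, 0) (by simp))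
  set ε' := ε / ((1 + M) * (N + 1)) with hε'
  have hε'0 : 0 < ε' := by positivity
  obtain ⟨η1, hη1, h1⟩ := unif_aux hAc hε'0
  obtain ⟨η2, hη2, h2⟩ := taylor_aux hAt hAtc hε'0
  refine ⟨min η1 η2, lt_min hη1 hη2, fun t ht t' ht' htt => ?_⟩
  set δ := t' - t with hδ
  have huN : ∀ s ∈ Icc (0:ℝ) 1, ‖u t s‖ ≤ N := fun s hs =>
    (skew_norm_parallel (A := fun s => A s t) (fun s hs v => hAskew s hs t ht v)
      (hu t ht) s hs).trans (hu0 t ht)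
  have key := skew_norm_le_const (a := 0) (b := 1) zero_le_one
    (w := fun s => u t' s - u t s + δ • B s t (u t s)) (A := fun s => A s t')
    (g := fun s => δ • ((Bs s t - At s t + (A s t).comp (B s t) - (B s t).comp (A s t)) (u t s))
      + δ • ((A s t' - A s t) (B s t (u t s))) - (A s t' - A s t - δ • At s t) (u t s))
    (m := (κ * N + ε) * |δ|)
    (fun s hs => hAskew s hs t' ht' _)
    (fun s hs => by
      have d1 := hu t' ht' s hs
      have d2 := hu t ht s hs
      have d3 := (hBs s hs t ht).clm_apply d2
      refine ((d1.sub d2).add (d3.const_smul δ)).congr_deriv ?_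
      simp only [sub_apply, add_apply,
        smul_apply, ContinuousLinearMap.comp_apply, map_add, map_sub,
        map_smul, map_neg, smul_add, smul_sub, smul_neg]
      abel)
    (fun s hs => by
      have b1 := hK s hs t ht
      have b2 := h1 s hs t ht t' ht' (htt.trans_le (min_le_left _ _))
      have b3 := h2 s hs t ht t' ht' (htt.trans_le (min_le_right _ _))
      have b4 := hM (s, t) ⟨hs, ht⟩
      have b5 := huN s hs
      simp only [Function.uncurry] at b4
      have c1 : ‖δ • ((Bs s t - At s t + (A s t).comp (B s t) - (B s t).comp (A s t)) (u t s))‖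
          ≤ |δ| * (κ * N) := by
        rw [norm_smul, Real.norm_eq_abs]
        gcongr
        exact (ContinuousLinearMap.le_opNorm _ _).trans
          (mul_le_mul b1 b5 (norm_nonneg _) ((norm_nonneg _).trans b1))
      have c2 : ‖δ • ((A s t' - A s t) (B s t (u t s)))‖ ≤ |δ| * (ε' * (M * N)) := by
        rw [norm_smul, Real.norm_eq_abs]
        gcongr
        refine (ContinuousLinearMap.le_opNorm _ _).trans ?_
        gcongr
        exact (ContinuousLinearMap.le_opNorm _ _).trans (by gcongr)
      have c3 : ‖(A s t' - A s t - δ • At s t) (u t s)‖ ≤ (ε' * |δ|) * N := by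
        refine (ContinuousLinearMap.le_opNorm _ _).trans ?_
        gcongr
      refine ((norm_sub_le _ _).trans (add_le_add (norm_add_le _ _) le_rfl)).trans ?_
      refine (add_le_add (add_le_add c1 c2) c3).trans ?_
      have : ε' * ((1 + M) * (N + 1)) = ε := by rw [hε']; field_simp
      have h0 : 0 ≤ |δ| * (ε' * (1 + M)) := by positivity
      rw [← this]
      nlinarith)
  simpa [hB0 t ht, hu00 t ht t' ht'] using key

lemma hol_square {A B At Bs : ℝ → ℝ → F →L[ℝ] F} {κ N : ℝ} {u : ℝ → ℝ → F} {q : ℝ → F}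
    (hN : 0 ≤ N)
    (hAskew : ∀ s ∈ Icc (0:ℝ) 1, ∀ t ∈ Icc (0:ℝ) 1, ∀ v, ⟪A s t v, v⟫ = 0)
    (hBskew : ∀ t ∈ Icc (0:ℝ) 1, ∀ v, ⟪B 1 t v, v⟫ = 0)
    (hAt : ∀ s ∈ Icc (0:ℝ) 1, ∀ t ∈ Icc (0:ℝ) 1,
      HasDerivWithinAt (fun t => A s t) (At s t) (Icc 0 1) t)
    (hBs : ∀ s ∈ Icc (0:ℝ) 1, ∀ t ∈ Icc (0:ℝ) 1,
      HasDerivWithinAt (fun s => B s t) (Bs s t) (Icc 0 1) s)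
    (hAc : ContinuousOn (Function.uncurry A) (Icc (0:ℝ) 1 ×ˢ Icc (0:ℝ) 1))
    (hBc : ContinuousOn (Function.uncurry B) (Icc (0:ℝ) 1 ×ˢ Icc (0:ℝ) 1))
    (hAtc : ContinuousOn (Function.uncurry At) (Icc (0:ℝ) 1 ×ˢ Icc (0:ℝ) 1))
    (hB0 : ∀ t ∈ Icc (0:ℝ) 1, B 0 t = 0)
    (hK : ∀ s ∈ Icc (0:ℝ) 1, ∀ t ∈ Icc (0:ℝ) 1,
      ‖Bs s t - At s t + (A s t).comp (B s t) - (B s t).comp (A s t)‖ ≤ κ)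
    (hu : ∀ t ∈ Icc (0:ℝ) 1, ∀ s ∈ Icc (0:ℝ) 1,
      HasDerivWithinAt (u t) (-(A s t (u t s))) (Icc (0:ℝ) 1) s)
    (hu0 : ∀ t ∈ Icc (0:ℝ) 1, ‖u t 0‖ ≤ N)
    (hu00 : ∀ t ∈ Icc (0:ℝ) 1, ∀ t' ∈ Icc (0:ℝ) 1, u t 0 = u t' 0)
    (hq : ∀ t ∈ Icc (0:ℝ) 1, HasDerivWithinAt q (-(B 1 t (q t))) (Icc (0:ℝ) 1) t)
    (hq0 : q 0 = u 0 1) :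
    ‖u 1 1 - q 1‖ ≤ κ * N := by
  have est : ∀ t ∈ Icc (0:ℝ) 1, ∀ ε > 0, ∀ᶠ t' in nhdsWithin t (Icc 0 1),
      ‖(u t' 1 - q t') - (u t 1 - q t) + (t' - t) • B 1 t (u t 1 - q t)‖
        ≤ (κ * N + ε) * |t' - t| := by
    intro t ht ε hε
    obtain ⟨η, hη, h⟩ := hol_step hN hAskew hAt hBs hAc hBc hAtc hB0 hK hu hu0 hu00
      (half_pos hε)
    have h2 := (hasDerivWithinAt_iff_isLittleO.mp (hq t ht)).def (half_pos hε)
    have h3 : ∀ᶠ t' in nhdsWithin t (Icc (0:ℝ) 1), |t' - t| < η := by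
      apply mem_nhdsWithin_of_mem_nhds
      exact Metric.ball_mem_nhds t hη
    filter_upwards [h2, h3, self_mem_nhdsWithin] with t' g2 g3 g4
    have g1 := h t ht t' g4 g3
    have e : (u t' 1 - q t') - (u t 1 - q t) + (t' - t) • B 1 t (u t 1 - q t)
        = (u t' 1 - u t 1 + (t' - t) • B 1 t (u t 1))
          - (q t' - q t - (t' - t) • -(B 1 t (q t))) := by
      simp only [map_sub, smul_sub, smul_neg]; abel
    rw [e]
    refine (norm_sub_le _ _).trans ?_
    rw [Real.norm_eq_abs] at g2
    nlinarith
  set e : ℝ → F := fun t => u t 1 - q t with he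
  have hcont : ContinuousOn (fun t => ‖e t‖) (Icc 0 1) := by
    refine ContinuousOn.norm ?_
    intro t ht
    have h1 := est t ht 1 one_pos
    have h2 : Filter.Tendsto (fun t' => e t' - e t + (t' - t) • B 1 t (e t))
        (nhdsWithin t (Icc 0 1)) (nhds 0) := by
      refine squeeze_zero_norm' h1 ?_
      have : Continuous (fun t' : ℝ => (κ * N + 1) * |t' - t|) := by fun_prop
      have := this.tendsto t
      simp only [sub_self, abs_zero, mul_zero] at this
      exact this.mono_left nhdsWithin_le_nhds
    have h3 : Filter.Tendsto (fun t' : ℝ => e t - (t' - t) • B 1 t (e t))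
        (nhdsWithin t (Icc 0 1)) (nhds (e t)) := by
      have : Continuous (fun t' : ℝ => e t - (t' - t) • B 1 t (e t)) := by fun_prop
      have := this.tendsto t
      simp only [sub_self, zero_smul, sub_zero] at this
      exact this.mono_left nhdsWithin_le_nhds
    have h4 := h2.add h3
    rw [zero_add] at h4
    refine h4.congr (fun t' => ?_)
    abel
  have fin := image_le_of_liminf_slope_right_le_deriv_boundary (f := fun t => ‖e t‖)
    (a := 0) (b := 1) hcont (B := fun t => κ * N * t) (B' := fun _ => κ * N)
    (by simp [he, hq0]) (by fun_prop)
    (fun t _ => by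
      have := (hasDerivAt_id t).const_mul (κ * N)
      simpa using this.hasDerivWithinAt)
    (fun t ht r hr => by
      have ht' : t ∈ Icc (0:ℝ) 1 := ⟨ht.1, ht.2.le⟩
      set ε := (r - κ * N) / 2 with hε
      have hε0 : 0 < ε := by rw [hε]; linarith
      apply Filter.Eventually.frequently
      have g1 := Filter.Eventually.filter_mono
        (nhdsWithin_le_of_mem (Icc_mem_nhdsGT_of_mem ht)) (est t ht' ε hε0)
      set c := ‖B 1 t‖
      have g2 : ∀ᶠ t' in nhdsWithin t (Ioi t), (t' - t) * c ^ 2 * ‖e t‖ < ε := by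
        have : Continuous (fun t' : ℝ => (t' - t) * c ^ 2 * ‖e t‖) := by fun_prop
        have h := this.tendsto t
        simp only [sub_self, zero_mul] at h
        exact (h.mono_left nhdsWithin_le_nhds).eventually (gt_mem_nhds hε0)
      filter_upwards [g1, g2, self_mem_nhdsWithin] with t' k1 k2 k3
      have hδ : 0 < t' - t := sub_pos.mpr k3
      rw [abs_of_pos hδ] at k1
      have k4 : ‖e t - (t' - t) • B 1 t (e t)‖ ≤ (1 + (t' - t) ^ 2 * c ^ 2) * ‖e t‖ := by
        refine (sq_le_sq₀ (norm_nonneg _) (by positivity)).mp ?_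
        rw [norm_sub_sq_real, inner_smul_right, real_inner_comm, hBskew t ht', norm_smul, mul_pow,
          Real.norm_eq_abs, sq_abs]
        have k5 : ‖B 1 t (e t)‖ ^ 2 ≤ c ^ 2 * ‖e t‖ ^ 2 := by
          rw [← mul_pow]; gcongr; exact ContinuousLinearMap.le_opNorm _ _
        have k6 : (t' - t) ^ 2 * ‖B 1 t (e t)‖ ^ 2 ≤ (t' - t) ^ 2 * (c ^ 2 * ‖e t‖ ^ 2) := by
          gcongr
        have k7 : 0 ≤ (t' - t) ^ 2 * c ^ 2 * ‖e t‖ ^ 2 := by positivity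
        have k8 : 0 ≤ ((t' - t) ^ 2 * c ^ 2 * ‖e t‖) ^ 2 := by positivity
        nlinarith
      have k9 : ‖e t'‖ ≤ ‖e t' - e t + (t' - t) • B 1 t (e t)‖ + ‖e t - (t' - t) • B 1 t (e t)‖ := by
        refine le_trans (le_of_eq ?_) (norm_add_le _ _)
        congr 1; abel
      rw [slope_def_field, div_lt_iff₀ hδ]
      have k10 : (t' - t) * ((t' - t) * c ^ 2 * ‖e t‖) < (t' - t) * ε := by gcongr
      have : r = κ * N + 2 * ε := by rw [hε]; ring
      rw [this]
      nlinarith)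
  have := fin (right_mem_Icc.mpr zero_le_one)
  simpa [he] using this

end Hol


section Tri
variable {F : Type*} [NormedAddCommGroup F] [InnerProductSpace ℝ F]
variable {E : Type*} [NormedAddCommGroup E] [NormedSpace ℝ E]

lemma ray_est {S : Set E} (hS : Convex ℝ S) {Γ : E → E →L[ℝ] F →L[ℝ] F}
    (hskew : ∀ z ∈ S, ∀ v u, ⟪Γ z v u, u⟫ = 0)
    {U : E → F} {DU : E → E →L[ℝ] F} (hU : ∀ z ∈ S, HasFDerivWithinAt U (DU z) S z)
    {a b : E} (ha : a ∈ S) (hb : b ∈ S) {u : ℝ → F}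
    (hu : ∀ s ∈ Icc (0:ℝ) 1,
      HasDerivWithinAt u (-(Γ (a + s • (b - a)) (b - a) (u s))) (Icc (0:ℝ) 1) s)
    {m : ℝ → ℝ} (hm : Continuous m)
    (hbd : ∀ s ∈ Icc (0:ℝ) 1, ‖(DU (a + s • (b - a)) + (Γ (a + s • (b - a))).flip
      (U (a + s • (b - a)))) (b - a)‖ ≤ m s) :
    ‖U b - u 1‖ ≤ ‖U a - u 0‖ + ∫ s in (0:ℝ)..1, m s := by
  have hmem : ∀ s ∈ Icc (0:ℝ) 1, a + s • (b - a) ∈ S := fun s hs =>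
    hS.add_smul_sub_mem ha hb hs
  have := skew_norm_le zero_le_one (w := fun s => U (a + s • (b - a)) - u s)
    (A := fun s => Γ (a + s • (b - a)) (b - a))
    (g := fun s => (DU (a + s • (b - a)) + (Γ (a + s • (b - a))).flip
      (U (a + s • (b - a)))) (b - a)) (fun s hs => hskew _ (hmem s hs) _ _)
    (fun s hs => by
      have hl : HasDerivWithinAt (fun s : ℝ => a + s • (b - a)) (b - a) (Icc 0 1) s := by
        have := ((hasDerivWithinAt_id s (Icc (0:ℝ) 1)).smul_const (b - a)).const_add a
        simpa using this
      have d1 := (hU _ (hmem s hs)).comp_hasDerivWithinAt s hl hmem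
      refine (d1.sub (hu s hs)).congr_deriv ?_
      generalize a + s • (b - a) = z
      generalize b - a = d
      simp only [map_sub, add_apply, ContinuousLinearMap.flip_apply]
      abel) hm hbd
  simpa using this

lemma hol_triangle [FiniteDimensional ℝ F] {S : Set E} (hS : Convex ℝ S)
    {Γ : E → E →L[ℝ] F →L[ℝ] F}
    {DΓ : E → E →L[ℝ] E →L[ℝ] F →L[ℝ] F}
    (hΓ : ∀ z ∈ S, HasFDerivWithinAt Γ (DΓ z) S z)
    (hDΓ : ContinuousOn DΓ S)
    (hskew : ∀ z ∈ S, ∀ v u, ⟪Γ z v u, u⟫ = 0) {β : ℝ} (hβ : 0 ≤ β)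
    (hK : ∀ z ∈ S, ∀ v w, ‖((DΓ z) v) w - ((DΓ z) w) v
            + ((Γ z) v).comp ((Γ z) w) - ((Γ z) w).comp ((Γ z) v)‖ ≤ β * ‖v‖ * ‖w‖)
    {a x y : E} (ha : a ∈ S) (hx : x ∈ S) (hy : y ∈ S) {D : ℝ}
    (hD : ∀ t ∈ Icc (0:ℝ) 1, ‖y + t • (x - y) - a‖ ≤ D) (w : F) :
    ∃ u : ℝ → ℝ → F, (∀ t, u t 0 = w) ∧ (∀ t ∈ Icc (0:ℝ) 1, ∀ s ∈ Icc (0:ℝ) 1,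
      HasDerivWithinAt (u t) (-(Γ (a + s • (y + t • (x - y) - a)) (y + t • (x - y) - a) (u t s)))
        (Icc (0:ℝ) 1) s) ∧
      ∀ q : ℝ → F, q 0 = u 0 1 → (∀ t ∈ Icc (0:ℝ) 1,
        HasDerivWithinAt q (-(Γ (y + t • (x - y)) (x - y) (q t))) (Icc (0:ℝ) 1) t) →
        ‖u 1 1 - q 1‖ ≤ β * D * ‖x - y‖ * ‖w‖ := by
  have hΓc : ContinuousOn Γ S := fun z hz => (hΓ z hz).continuousWithinAt
  have hbmem : ∀ t ∈ Icc (0:ℝ) 1, y + t • (x - y) ∈ S := fun t ht => hS.add_smul_sub_mem hy hx ht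
  have hmem : ∀ s ∈ Icc (0:ℝ) 1, ∀ t ∈ Icc (0:ℝ) 1, a + s • (y + t • (x - y) - a) ∈ S :=
    fun s hs t ht => hS.add_smul_sub_mem ha (hbmem t ht) hs
  have hls : ∀ s t : ℝ, HasDerivWithinAt (fun s : ℝ => a + s • (y + t • (x - y) - a))
      (y + t • (x - y) - a) (Icc 0 1) s := by
    intro s t
    have := ((hasDerivWithinAt_id s (Icc (0:ℝ) 1)).smul_const (y + t • (x - y) - a)).const_add a
    simpa using this
  have hbt : ∀ t : ℝ, HasDerivWithinAt (fun t : ℝ => y + t • (x - y) - a)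
      (x - y) (Icc 0 1) t := by
    intro t
    have := (((hasDerivWithinAt_id t (Icc (0:ℝ) 1)).smul_const (x - y)).const_add y).sub_const a
    simpa using this
  have hlt : ∀ s t : ℝ, HasDerivWithinAt (fun t : ℝ => a + s • (y + t • (x - y) - a))
      (s • (x - y)) (Icc 0 1) t := by
    intro s t
    exact ((hbt t).const_smul s).const_add a
  have hΓs : ∀ s ∈ Icc (0:ℝ) 1, ∀ t ∈ Icc (0:ℝ) 1,
      HasDerivWithinAt (fun s => Γ (a + s • (y + t • (x - y) - a)))
        (DΓ (a + s • (y + t • (x - y) - a)) (y + t • (x - y) - a)) (Icc 0 1) s :=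
    fun s hs t ht => by
      have h := hΓ _ (hmem s hs t ht)
      exact HasFDerivWithinAt.comp_hasDerivWithinAt (l := Γ) s h (hls s t)
        (fun r hr => hmem r hr t ht)
  have hΓt : ∀ s ∈ Icc (0:ℝ) 1, ∀ t ∈ Icc (0:ℝ) 1,
      HasDerivWithinAt (fun t => Γ (a + s • (y + t • (x - y) - a)))
        (DΓ (a + s • (y + t • (x - y) - a)) (s • (x - y))) (Icc 0 1) t :=
    fun s hs t ht => by
      have h := hΓ _ (hmem s hs t ht)
      exact HasFDerivWithinAt.comp_hasDerivWithinAt (l := Γ) t h (hlt s t)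
        (fun r hr => hmem s hs r hr)
  have hγc : Continuous (fun z : ℝ × ℝ => a + z.1 • (y + z.2 • (x - y) - a)) := by fun_prop
  have hdc : Continuous (fun z : ℝ × ℝ => (y + z.2 • (x - y) - a)) := by fun_prop
  have hvc : Continuous (fun z : ℝ × ℝ => z.1 • (x - y)) := by fun_prop
  have hmaps : MapsTo (fun z : ℝ × ℝ => a + z.1 • (y + z.2 • (x - y) - a))
      (Icc (0:ℝ) 1 ×ˢ Icc (0:ℝ) 1) S := fun z hz => hmem z.1 hz.1 z.2 hz.2
  have hΓγ := hΓc.comp hγc.continuousOn hmaps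
  have hDΓγ := hDΓ.comp hγc.continuousOn hmaps
  have hAc := hΓγ.clm_apply hdc.continuousOn
  have hex : ∀ t : ℝ, ∃ u : ℝ → F, u 0 = w ∧ (t ∈ Icc (0:ℝ) 1 → ∀ s ∈ Icc (0:ℝ) 1,
      HasDerivWithinAt u (-(Γ (a + s • (y + t • (x - y) - a)) (y + t • (x - y) - a) (u s)))
        (Icc (0:ℝ) 1) s) := by
    intro t
    by_cases ht : t ∈ Icc (0:ℝ) 1
    · obtain ⟨u, h0, h1⟩ := exists_parallel
        (A := fun s => Γ (a + s • (y + t • (x - y) - a)) (y + t • (x - y) - a))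
        (by
          have hc : ContinuousOn (fun s : ℝ => Γ (a + s • (y + t • (x - y) - a))) (Icc 0 1) :=
            hΓc.comp (by fun_prop) (fun s hs => hmem s hs t ht)
          exact hc.clm_apply continuousOn_const)
        (fun s hs v => hskew _ (hmem s hs t ht) _ _) w
      exact ⟨u, h0, fun _ => h1⟩
    · exact ⟨fun _ => w, rfl, fun h => absurd h ht⟩
  choose u hu0 hu using hex
  refine ⟨u, hu0, hu, fun q hq0 hq => ?_⟩
  refine hol_square (u := u) (q := q) (κ := β * D * ‖x - y‖) (N := ‖w‖)
    (A := fun s t => Γ (a + s • (y + t • (x - y) - a)) (y + t • (x - y) - a))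
    (B := fun s t => Γ (a + s • (y + t • (x - y) - a)) (s • (x - y)))
    (At := fun s t => DΓ (a + s • (y + t • (x - y) - a)) (s • (x - y)) (y + t • (x - y) - a)
      + Γ (a + s • (y + t • (x - y) - a)) (x - y))
    (Bs := fun s t => DΓ (a + s • (y + t • (x - y) - a)) (y + t • (x - y) - a) (s • (x - y))
      + Γ (a + s • (y + t • (x - y) - a)) (x - y))
    (norm_nonneg _) (fun s hs t ht v => hskew _ (hmem s hs t ht) _ _)
    (fun t ht v => hskew _ (hmem 1 (by simp) t ht) _ _)
    ?_ ?_ hAc (hΓγ.clm_apply hvc.continuousOn) ?_ ?_ ?_ hu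
    (fun t _ => by rw [hu0]) (fun t _ t' _ => by rw [hu0, hu0]) ?_ hq0
  · intro s hs t ht
    exact (hΓt s hs t ht).clm_apply (hbt t)
  · intro s hs t ht
    refine (hΓs s hs t ht).clm_apply ?_
    simpa using ((hasDerivWithinAt_id s (Icc (0:ℝ) 1)).smul_const (x - y))
  · exact ((hDΓγ.clm_apply hvc.continuousOn).clm_apply hdc.continuousOn).add
      (hΓγ.clm_apply continuousOn_const)
  · intro t ht
    simp
  · intro s hs t ht
    have h1 := hK _ (hmem s hs t ht) (y + t • (x - y) - a) (s • (x - y))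
    have h2 : ‖s • (x - y)‖ ≤ ‖x - y‖ := by
      rw [norm_smul, Real.norm_eq_abs, abs_of_nonneg hs.1]
      exact mul_le_of_le_one_left (norm_nonneg _) hs.2
    have h3 := hD t ht
    simp only [add_sub_add_right_eq_sub]
    refine h1.trans ?_
    have : 0 ≤ D := (norm_nonneg _).trans h3
    gcongr
  · intro t ht
    simpa using hq t ht

lemma triangle_est [FiniteDimensional ℝ F] {S : Set E} (hS : Convex ℝ S)
    {Γ : E → E →L[ℝ] F →L[ℝ] F}
    {DΓ : E → E →L[ℝ] E →L[ℝ] F →L[ℝ] F}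
    (hΓ : ∀ z ∈ S, HasFDerivWithinAt Γ (DΓ z) S z)
    (hDΓ : ContinuousOn DΓ S)
    (hskew : ∀ z ∈ S, ∀ v u, ⟪Γ z v u, u⟫ = 0) {β : ℝ} (hβ : 0 ≤ β)
    (hK : ∀ z ∈ S, ∀ v w, ‖((DΓ z) v) w - ((DΓ z) w) v
            + ((Γ z) v).comp ((Γ z) w) - ((Γ z) w).comp ((Γ z) v)‖ ≤ β * ‖v‖ * ‖w‖)
    {U : E → F} {DU : E → E →L[ℝ] F} (hU : ∀ z ∈ S, HasFDerivWithinAt U (DU z) S z)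
    {a x y : E} (ha : a ∈ S) (hx : x ∈ S) (hy : y ∈ S) {D : ℝ}
    (hD : ∀ t ∈ Icc (0:ℝ) 1, ‖y + t • (x - y) - a‖ ≤ D)
    {P : ℝ → F →L[ℝ] F} (hP1 : P 1 = ContinuousLinearMap.id ℝ F)
    (hP : ∀ t ∈ Icc (0:ℝ) 1, HasDerivWithinAt P
            (-((Γ ((1 - t) • x + t • y)) (y - x)).comp (P t)) (Icc (0:ℝ) 1) t)
    {m₁ m₂ : ℝ → ℝ} (hm₁ : Continuous m₁) (hm₂ : Continuous m₂)
    (hbd₁ : ∀ s ∈ Icc (0:ℝ) 1, ‖(DU (a + s • (x - a)) + (Γ (a + s • (x - a))).flip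
      (U (a + s • (x - a)))) (x - a)‖ ≤ m₁ s)
    (hbd₂ : ∀ s ∈ Icc (0:ℝ) 1, ‖(DU (a + s • (y - a)) + (Γ (a + s • (y - a))).flip
      (U (a + s • (y - a)))) (y - a)‖ ≤ m₂ s) :
    ‖U x - P 0 (U y)‖ ≤ (∫ s in (0:ℝ)..1, m₁ s) + (∫ s in (0:ℝ)..1, m₂ s)
      + β * D * ‖x - y‖ * ‖U a‖ := by
  obtain ⟨u, hu0, hu, hq⟩ := hol_triangle hS hΓ hDΓ hskew hβ hK ha hx hy hD (U a)
  have hflip : ∀ v : F, ∀ t ∈ Icc (0:ℝ) 1, HasDerivWithinAt (fun t => P (1 - t) v)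
      (-(Γ (y + t • (x - y)) (x - y) (P (1 - t) v))) (Icc (0:ℝ) 1) t := by
    intro v t ht
    have h1t : 1 - t ∈ Icc (0:ℝ) 1 := ⟨by linarith [ht.2], by linarith [ht.1]⟩
    have h0 := hP (1 - t) h1t
    have h1 := h0.scomp t (h := fun t => 1 - t) (h' := -1) (s := Icc 0 1)
      (((hasDerivAt_id t).const_sub 1).hasDerivWithinAt)
      (fun r hr => ⟨by linarith [hr.2], by linarith [hr.1]⟩)
    have h2 := h1.clm_apply (hasDerivWithinAt_const t (Icc (0:ℝ) 1) v)
    refine h2.congr_deriv ?_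
    have e1 : (1 - (1 - t)) • x + (1 - t) • y = y + t • (x - y) := by module
    have e2 : y - x = -(x - y) := by abel
    rw [e1, e2]
    simp
  have hPn : ∀ v, ‖P 0 v‖ ≤ ‖v‖ := by
    intro v
    have := skew_norm_parallel (A := fun t => Γ (y + t • (x - y)) (x - y))
      (fun t ht v => hskew _ (hS.add_smul_sub_mem hy hx ht) _ _) (hflip v) 1 (by simp)
    simpa [hP1] using this
  have k1 := ray_est hS hskew hU ha hx (u := u 1)
    (fun s hs => by simpa using hu 1 (by simp) s hs) hm₁ hbd₁
  have k2 := ray_est hS hskew hU ha hy (u := u 0)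
    (fun s hs => by simpa using hu 0 (by simp) s hs) hm₂ hbd₂
  have k3 := hq (fun t => P (1 - t) (u 0 1)) (by simp [hP1]) (hflip _)
  simp only [hu0, sub_self, norm_zero, zero_add] at k1 k2 k3
  have k4 := hPn (u 0 1 - U y)
  rw [norm_sub_rev (u 0 1)] at k4
  have e : U x - P 0 (U y) = (U x - u 1 1) + P 0 (u 0 1 - U y) + (u 1 1 - P 0 (u 0 1)) := by
    rw [map_sub]; abel
  rw [e]
  refine (norm_add_le _ _).trans ?_
  refine (add_le_add (norm_add_le _ _) le_rfl).trans ?_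
  linarith

end Tri


section Ints

lemma lint_scale {σ : ℝ} (hσ : 0 < σ) {f : ℝ → ℝ≥0∞} (hf : Measurable f) :
    ∫⁻ r in Ioi (0:ℝ), f (σ * r) = ENNReal.ofReal σ⁻¹ * ∫⁻ r in Ioi (0:ℝ), f r := by
  rw [← lintegral_indicator measurableSet_Ioi, ← lintegral_indicator measurableSet_Ioi]
  have e : (fun r => (Ioi (0:ℝ)).indicator (fun r => f (σ * r)) r)
      = fun r => ((Ioi (0:ℝ)).indicator f) (σ * r) := by
    funext r
    by_cases h : 0 < r
    · have : 0 < σ * r := by positivity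
      simp [indicator, h, this]
    · have : ¬ 0 < σ * r := by
        simp only [not_lt] at h ⊢
        exact mul_nonpos_of_nonneg_of_nonpos hσ.le h
      simp [indicator, h, this]
  rw [e, ← lintegral_map (f := (Ioi (0:ℝ)).indicator f) (g := fun r => σ * r)
    (hf.indicator measurableSet_Ioi) (by fun_prop), Real.map_volume_mul_left hσ.ne',
    lintegral_smul_measure, abs_of_pos (inv_pos.mpr hσ)]
  rfl

noncomputable def cSph (n : ℕ) : ℝ≥0∞ :=
  (volume : Measure (EuclideanSpace ℝ (Fin n))).toSphere univ

lemma cSph_ne_top (n : ℕ) : cSph n ≠ ⊤ := measure_ne_top _ _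

lemma lint_polar {n : ℕ} (hn : 1 ≤ n) {f : ℝ → ℝ≥0∞} (hf : Measurable f) :
    ∫⁻ h : EuclideanSpace ℝ (Fin n), f ‖h‖
      = cSph n * ∫⁻ r in Ioi (0:ℝ), ENNReal.ofReal (r ^ (n - 1)) * f r := by
  haveI : Nonempty (Fin n) := ⟨⟨0, hn⟩⟩
  set μ := (volume : Measure (EuclideanSpace ℝ (Fin n)))
  have hfr : Module.finrank ℝ (EuclideanSpace ℝ (Fin n)) = n := by simp
  have hmp := μ.measurePreserving_homeomorphUnitSphereProd
  calc
    ∫⁻ h, f ‖h‖ ∂μ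
      = ∫⁻ x : ({(0)}ᶜ : Set (EuclideanSpace ℝ (Fin n))), f (‖x.1‖) ∂(μ.comap (↑)) := by
      rw [lintegral_subtype_comap (measurableSet_singleton _).compl fun x ↦ f (‖x‖),
        restrict_compl_singleton]
    _ = ∫⁻ x, f x.2 ∂μ.toSphere.prod (.volumeIoiPow (n - 1)) := by
      rw [hfr] at hmp
      rw [← hmp.lintegral_comp (by fun_prop)]
      simp
    _ = μ.toSphere univ * ∫⁻ x : Ioi (0 : ℝ), f x ∂.volumeIoiPow (n - 1) := by
      rw [lintegral_prod _ (by fun_prop)]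
      simp [mul_comm]
    _ = _ := by
      rw [cSph, Measure.volumeIoiPow, lintegral_withDensity_eq_lintegral_mul _ (by fun_prop)
        (by fun_prop)]
      congr 1
      exact lintegral_subtype_comap measurableSet_Ioi
        (fun r => ENNReal.ofReal (r ^ (n - 1)) * f r)

lemma lint_slice {n : ℕ} (hn : 1 ≤ n) {f : EuclideanSpace ℝ (Fin n) × ℝ → ℝ≥0∞}
    (hf : Measurable f) {σ : ℝ} (hσ : 0 < σ) (c : ℝ) :
    ∫⁻ h : EuclideanSpace ℝ (Fin n), ∫⁻ x : EuclideanSpace ℝ (Fin n),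
        ENNReal.ofReal (‖h‖ ^ (1 - (n:ℝ))) * f (x + c • h, σ * ‖h‖)
      = cSph n * ENNReal.ofReal σ⁻¹ *
        ∫⁻ x : EuclideanSpace ℝ (Fin n), ∫⁻ t in Ioi (0:ℝ), f (x, t) := by
  have h1 : ∀ h : EuclideanSpace ℝ (Fin n), ∫⁻ x : EuclideanSpace ℝ (Fin n),
        ENNReal.ofReal (‖h‖ ^ (1 - (n:ℝ))) * f (x + c • h, σ * ‖h‖)
      = ENNReal.ofReal (‖h‖ ^ (1 - (n:ℝ))) * ∫⁻ x : EuclideanSpace ℝ (Fin n), f (x, σ * ‖h‖) := by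
    intro h
    rw [lintegral_const_mul _ (by fun_prop)]
    rw [lintegral_add_right_eq_self (fun x => f (x, σ * ‖h‖))]
  have hΦ : Measurable (fun t : ℝ => ∫⁻ x : EuclideanSpace ℝ (Fin n), f (x, t)) :=
    hf.lintegral_prod_left'
  simp_rw [h1]
  rw [lint_polar hn (f := fun r => ENNReal.ofReal (r ^ (1 - (n:ℝ))) *
    ∫⁻ x : EuclideanSpace ℝ (Fin n), f (x, σ * r)) (by
      apply Measurable.mul (by fun_prop)
      exact hΦ.comp (measurable_const_mul σ))]
  rw [mul_assoc]
  congr 1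
  rw [lintegral_lintegral_swap (f := fun x t => f (x, t)) (by
    exact hf.aemeasurable)]
  rw [← lint_scale hσ hΦ]
  refine setLIntegral_congr_fun measurableSet_Ioi (fun r hr => ?_)
  have hr : 0 < r := hr
  rw [← mul_assoc, ← ENNReal.ofReal_mul (by positivity), ← Real.rpow_natCast, ← Real.rpow_add hr]
  have : ((n - 1 : ℕ) : ℝ) + (1 - (n:ℝ)) = 0 := by
    rw [Nat.cast_sub hn]; simp
  simp [this]

lemma lint_far {n : ℕ} (hn : 1 ≤ n) {p : ℝ} (hp : 1 < p) {ε : ℝ} (hε : 0 < ε) :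
    ∫⁻ h : EuclideanSpace ℝ (Fin n),
      (if ε < ‖h‖ then ENNReal.ofReal (‖h‖ ^ (-((n:ℝ) + p - 1))) else 0)
      = cSph n * ENNReal.ofReal (ε ^ (1 - p) / (p - 1)) := by
  have hm : Measurable (fun r : ℝ => if ε < r then ENNReal.ofReal (r ^ (-((n:ℝ) + p - 1))) else 0) :=
    Measurable.ite measurableSet_Ioi (by fun_prop) (by fun_prop)
  rw [lint_polar hn hm]
  congr 1
  have e : ∫⁻ r in Ioi (0:ℝ), ENNReal.ofReal (r ^ (n - 1)) *
      (if ε < r then ENNReal.ofReal (r ^ (-((n:ℝ) + p - 1))) else 0)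
      = ∫⁻ r in Ioi ε, ENNReal.ofReal (r ^ (-p)) := by
    rw [← lintegral_indicator measurableSet_Ioi, ← lintegral_indicator measurableSet_Ioi]
    congr 1
    funext r
    by_cases h : ε < r
    · have hr : 0 < r := hε.trans h
      simp only [indicator, mem_Ioi, h, hr, if_true]
      rw [← ENNReal.ofReal_mul (by positivity), ← Real.rpow_natCast, ← Real.rpow_add hr]
      congr 2
      rw [Nat.cast_sub hn]; push_cast; ring
    · simp [indicator, h]
  rw [e, ← ofReal_integral_eq_lintegral_ofReal (integrableOn_Ioi_rpow_of_lt (by linarith) hε)]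
  · rw [integral_Ioi_rpow_of_lt (by linarith) hε]
    congr 1
    rw [show -p + 1 = 1 - p by ring, neg_div, ← div_neg, neg_sub]
  · refine (ae_restrict_iff' measurableSet_Ioi).mpr (Filter.Eventually.of_forall fun r hr => ?_)
    have : 0 < r := hε.trans hr
    simp only [Pi.zero_apply]
    positivity

lemma lint_holder {α : Type*} [MeasurableSpace α] (μ : Measure α) {p : ℝ} (hp : 1 < p)
    {f w : α → ℝ≥0∞} (hf : AEMeasurable f μ) (hw : AEMeasurable w μ)
    (hw0 : ∀ᵐ a ∂μ, w a ≠ 0) (hwt : ∀ᵐ a ∂μ, w a ≠ ⊤) :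
    (∫⁻ a, f a ∂μ) ^ p ≤ (∫⁻ a, w a ^ (-(1 / (p - 1))) ∂μ) ^ (p - 1) *
      ∫⁻ a, w a * f a ^ p ∂μ := by
  have hp0 : 0 < p := by linarith
  have hpq := (Real.HolderConjugate.conjExponent hp).symm
  set q := p.conjExponent with hq
  have hqd : q = p / (p - 1) := rfl
  have hp1 : p - 1 ≠ 0 := by linarith
  have h1 := ENNReal.lintegral_mul_le_Lp_mul_Lq μ hpq (f := fun a => w a ^ (-(1 / p)))
    (g := fun a => w a ^ (1 / p) * f a) (by fun_prop) (by fun_prop)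
  have e1 : ∫⁻ a, ((fun a => w a ^ (-(1 / p))) * fun a => w a ^ (1 / p) * f a) a ∂μ
      = ∫⁻ a, f a ∂μ := by
    refine lintegral_congr_ae ?_
    filter_upwards [hw0, hwt] with a h0 ht
    simp only [Pi.mul_apply]
    rw [← mul_assoc, ← ENNReal.rpow_add _ _ h0 ht]
    simp
  have e2 : ∀ a, (w a ^ (-(1 / p))) ^ q = w a ^ (-(1 / (p - 1))) := by
    intro a
    rw [← ENNReal.rpow_mul]
    congr 1
    rw [hqd]; field_simp
  have e3 : ∀ a, (w a ^ (1 / p) * f a) ^ p = w a * f a ^ p := by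
    intro a
    rw [ENNReal.mul_rpow_of_nonneg _ _ hp0.le, ← ENNReal.rpow_mul]
    congr 1
    rw [one_div_mul_cancel hp0.ne', ENNReal.rpow_one]
  rw [e1] at h1
  simp only [e2, e3] at h1
  have h2 := ENNReal.rpow_le_rpow h1 hp0.le
  refine h2.trans (le_of_eq ?_)
  rw [ENNReal.mul_rpow_of_nonneg _ _ hp0.le, ← ENNReal.rpow_mul, ← ENNReal.rpow_mul,
    one_div_mul_cancel hp0.ne', ENNReal.rpow_one]
  congr 2
  rw [hqd]; field_simp

lemma ennreal_add_rpow {p : ℝ} (hp : 1 < p) (a b : ℝ≥0∞) :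
    (a + b) ^ p ≤ 2 ^ p * (a ^ p + b ^ p) := by
  refine (ENNReal.rpow_add_le_mul_rpow_add_rpow a b hp.le).trans ?_
  gcongr
  · norm_num
  · linarith

lemma ennreal_add_rpow3 {p : ℝ} (hp : 1 < p) (a b c : ℝ≥0∞) :
    (a + b + c) ^ p ≤ 2 ^ p * 2 ^ p * (a ^ p + b ^ p + c ^ p) := by
  refine (ennreal_add_rpow hp _ _).trans ?_
  rw [mul_assoc]
  gcongr
  rw [mul_add]
  gcongr
  · exact ennreal_add_rpow hp _ _
  · refine le_mul_of_one_le_left zero_le ?_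
    exact ENNReal.one_le_rpow (by norm_num) (by linarith)

/-- the constant of the weighted Hoelder inequality on the unit interval -/
noncomputable def cI (p : ℝ) : ℝ≥0∞ := ∫⁻ s in Ioc (0:ℝ) 1, ENNReal.ofReal (s ^ (-(1 / p)))

lemma cI_ne_top {p : ℝ} (hp : 1 < p) : cI p ≠ ⊤ := by
  have h : IntervalIntegrable (fun s : ℝ => s ^ (-(1 / p))) volume 0 1 := by
    apply intervalIntegral.intervalIntegrable_rpow'
    have : 1 / p < 1 := by rw [div_lt_one (by linarith)]; exact hp
    linarith
  rw [intervalIntegrable_iff_integrableOn_Ioc_of_le zero_le_one] at h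
  have := h.lintegral_lt_top
  exact this.ne

lemma holder_unit {p : ℝ} (hp : 1 < p) {f : ℝ → ℝ≥0∞} (hf : Measurable f) :
    (∫⁻ s in Ioc (0:ℝ) 1, f s) ^ p ≤ cI p ^ (p - 1) *
      ∫⁻ s in Ioc (0:ℝ) 1, ENNReal.ofReal (s ^ (1 - 1 / p)) * f s ^ p := by
  have hp1 : p - 1 ≠ 0 := by linarith
  have hp0 : p ≠ 0 := by linarith
  have h := lint_holder (volume.restrict (Ioc (0:ℝ) 1)) hp hf.aemeasurable
    (w := fun s => ENNReal.ofReal (s ^ (1 - 1 / p))) (by fun_prop)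
    ((ae_restrict_iff' measurableSet_Ioc).mpr (Filter.Eventually.of_forall fun s hs => by
      have := Real.rpow_pos_of_pos hs.1 (1 - 1 / p)
      simpa using this))
    (Filter.Eventually.of_forall fun s => ENNReal.ofReal_ne_top)
  refine h.trans (le_of_eq ?_)
  congr 2
  refine setLIntegral_congr_fun measurableSet_Ioc (fun s hs => ?_)
  rw [ENNReal.ofReal_rpow_of_pos (Real.rpow_pos_of_pos hs.1 _), ← Real.rpow_mul hs.1.le]
  congr 2
  field_simp

lemma holder_eps {p : ℝ} (hp : 1 < p) {f : ℝ → ℝ≥0∞} (hf : Measurable f) {ε : ℝ} (hε : 0 < ε) :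
    (∫⁻ s in Ioc (0:ℝ) ε, f s) ^ p ≤ ENNReal.ofReal ε ^ (p - 1) *
      ∫⁻ s in Ioc (0:ℝ) ε, f s ^ p := by
  have h := lint_holder (volume.restrict (Ioc (0:ℝ) ε)) hp hf.aemeasurable
    (w := fun s => 1) (by fun_prop) (by simp) (by simp)
  simpa using h

end Ints


section Assemble

abbrev Eu (n : ℕ) := EuclideanSpace ℝ (Fin n)

lemma trace_T {n : ℕ} {p : ℝ} (hp : 1 < p) {ε : ℝ} (hε : 0 < ε)
    {g v : Eu n × ℝ → ℝ≥0∞} (hg : Measurable g) (hv : Measurable v) {V0 : Eu n → ℝ≥0∞}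
    (hV : ∀ x, ∀ t ∈ Ioc (0:ℝ) ε, V0 x ≤ v (x, t) + ∫⁻ s in Ioc (0:ℝ) ε, g (x, s)) :
    ENNReal.ofReal ε⁻¹ ^ (p - 1) * ∫⁻ x, V0 x ^ p
      ≤ 2 ^ p * ((∫⁻ x, ∫⁻ t in Ioi (0:ℝ), g (x, t) ^ p)
        + ENNReal.ofReal ε⁻¹ ^ p * ∫⁻ x, ∫⁻ t in Ioi (0:ℝ), v (x, t) ^ p) := by
  have hp0 : 0 < p := by linarith
  set e := ENNReal.ofReal ε⁻¹ with he
  set d := ENNReal.ofReal ε with hd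
  have hd0 : d ≠ 0 := by simpa [hd] using hε
  have hdt : d ≠ ⊤ := ENNReal.ofReal_ne_top
  have hed : e = d⁻¹ := by rw [he, hd, ENNReal.ofReal_inv_of_pos hε]
  have he0 : e ≠ 0 := by rw [hed]; simpa using hdt
  have het : e ≠ ⊤ := ENNReal.ofReal_ne_top
  have hed1 : e * d = 1 := by rw [hed]; exact ENNReal.inv_mul_cancel hd0 hdt
  have hsub : Ioc (0:ℝ) ε ⊆ Ioi 0 := Ioc_subset_Ioi_self
  have key : ∀ x, e ^ (p - 1) * V0 x ^ p ≤ 2 ^ p * ((∫⁻ t in Ioi (0:ℝ), g (x, t) ^ p)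
        + e ^ p * ∫⁻ t in Ioi (0:ℝ), v (x, t) ^ p) := by
    intro x
    have h1 : d * V0 x ^ p ≤ 2 ^ p * ((∫⁻ t in Ioi (0:ℝ), v (x, t) ^ p)
        + d * (d ^ (p - 1) * ∫⁻ t in Ioi (0:ℝ), g (x, t) ^ p)) := by
      calc d * V0 x ^ p = ∫⁻ t in Ioc (0:ℝ) ε, V0 x ^ p := by
            rw [setLIntegral_const, Real.volume_Ioc, sub_zero, mul_comm]
        _ ≤ ∫⁻ t in Ioc (0:ℝ) ε, 2 ^ p * (v (x, t) ^ p
              + d ^ (p - 1) * ∫⁻ t in Ioi (0:ℝ), g (x, t) ^ p) := by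
            refine setLIntegral_mono' measurableSet_Ioc (fun t ht => ?_)
            refine (ENNReal.rpow_le_rpow (hV x t ht) hp0.le).trans ?_
            refine (ennreal_add_rpow hp _ _).trans ?_
            gcongr
            refine (holder_eps hp (f := fun s => g (x, s)) (by fun_prop) hε).trans ?_
            gcongr
        _ = 2 ^ p * ((∫⁻ t in Ioc (0:ℝ) ε, v (x, t) ^ p)
              + d * (d ^ (p - 1) * ∫⁻ t in Ioi (0:ℝ), g (x, t) ^ p)) := by
            rw [lintegral_const_mul _ (by fun_prop), lintegral_add_right _ (by fun_prop),
              setLIntegral_const, Real.volume_Ioc, sub_zero]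
            rw [mul_comm d]
        _ ≤ _ := by gcongr
    have e1 : e ^ p * d = e ^ (p - 1) := by
      rw [ENNReal.rpow_sub _ _ he0 het, ENNReal.rpow_one, hed, div_eq_mul_inv, inv_inv]
    have e2 : e ^ p * (d * d ^ (p - 1)) = 1 := by
      rw [← mul_assoc, e1, hed, ENNReal.inv_rpow]
      refine ENNReal.inv_mul_cancel ?_ ?_
      · simp [ENNReal.rpow_eq_zero_iff, hd0, hdt]
      · simp [ENNReal.rpow_eq_top_iff, hd0, hdt]
    calc e ^ (p - 1) * V0 x ^ p = e ^ p * (d * V0 x ^ p) := by rw [← e1]; ring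
      _ ≤ e ^ p * (2 ^ p * ((∫⁻ t in Ioi (0:ℝ), v (x, t) ^ p)
        + d * (d ^ (p - 1) * ∫⁻ t in Ioi (0:ℝ), g (x, t) ^ p))) := by gcongr
      _ = 2 ^ p * ((e ^ p * (d * d ^ (p - 1))) * (∫⁻ t in Ioi (0:ℝ), g (x, t) ^ p)
        + e ^ p * ∫⁻ t in Ioi (0:ℝ), v (x, t) ^ p) := by ring
      _ = _ := by rw [e2, one_mul]
  have hm1 : Measurable fun x => ∫⁻ t in Ioi (0:ℝ), g (x, t) ^ p :=
    Measurable.lintegral_prod_right' (f := fun z => g z ^ p) (by fun_prop)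
  have hm2 : Measurable fun x => ∫⁻ t in Ioi (0:ℝ), v (x, t) ^ p :=
    Measurable.lintegral_prod_right' (f := fun z => v z ^ p) (by fun_prop)
  have hfin : e ^ (p - 1) ≠ ⊤ := by simp [ENNReal.rpow_eq_top_iff, he0, het]
  rw [← lintegral_const_mul' _ _ hfin]
  refine (lintegral_mono key).trans (le_of_eq ?_)
  rw [lintegral_const_mul _ (by fun_prop), lintegral_add_left hm1, lintegral_const_mul _ hm2]

/-- the weighted ray average -/
noncomputable def rayN {n : ℕ} (p : ℝ) (g : Eu n × ℝ → ℝ≥0∞) (x h : Eu n) : ℝ≥0∞ :=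
  ∫⁻ s in Ioc (0:ℝ) 1, ENNReal.ofReal (s ^ (1 - 1 / p)) * g (x + (s / 2) • h, s * ‖h‖) ^ p

lemma rayN_meas {n : ℕ} (p : ℝ) {g : Eu n × ℝ → ℝ≥0∞} (hg : Measurable g) :
    Measurable (fun z : Eu n × Eu n => rayN p g z.1 z.2) := by
  unfold rayN
  refine Measurable.lintegral_prod_right' (f := fun q : (Eu n × Eu n) × ℝ =>
    ENNReal.ofReal (q.2 ^ (1 - 1 / p)) * g (q.1.1 + (q.2 / 2) • q.1.2, q.2 * ‖q.1.2‖) ^ p) ?_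
  fun_prop

lemma rayN_int {n : ℕ} (hn : 1 ≤ n) {p : ℝ} (hp : 1 < p) {g : Eu n × ℝ → ℝ≥0∞}
    (hg : Measurable g) :
    ∫⁻ x : Eu n, ∫⁻ h : Eu n, ENNReal.ofReal (‖h‖ ^ (1 - (n:ℝ))) * rayN p g x h
      = cSph n * cI p * ∫⁻ x, ∫⁻ t in Ioi (0:ℝ), g (x, t) ^ p := by
  have hN := rayN_meas p hg
  rw [lintegral_lintegral_swap (by
    refine Measurable.aemeasurable ?_
    simp only [Function.uncurry_def]
    fun_prop)]
  set Φ : (Eu n × Eu n) × ℝ → ℝ≥0∞ := fun q => ENNReal.ofReal (‖q.1.1‖ ^ (1 - (n:ℝ))) *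
    (ENNReal.ofReal (q.2 ^ (1 - 1 / p)) *
      g (q.1.2 + (q.2 / 2) • q.1.1, q.2 * ‖q.1.1‖) ^ p) with hΦ
  have hΦm : Measurable Φ := by fun_prop
  have h1 : ∀ h x : Eu n, ENNReal.ofReal (‖h‖ ^ (1 - (n:ℝ))) * rayN p g x h
      = ∫⁻ s in Ioc (0:ℝ) 1, Φ ((h, x), s) := by
    intro h x
    simp only [rayN, hΦ]
    rw [lintegral_const_mul _ (by fun_prop)]
  simp_rw [h1]
  have h2 : ∀ h : Eu n, ∫⁻ x : Eu n, ∫⁻ s in Ioc (0:ℝ) 1, Φ ((h, x), s)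
      = ∫⁻ s in Ioc (0:ℝ) 1, ∫⁻ x : Eu n, Φ ((h, x), s) := by
    intro h
    refine lintegral_lintegral_swap (Measurable.aemeasurable ?_)
    simp only [Function.uncurry_def]
    fun_prop
  simp_rw [h2]
  rw [lintegral_lintegral_swap (by
    refine Measurable.aemeasurable ?_
    simp only [Function.uncurry_def]
    exact Measurable.lintegral_prod_right' (f := fun q : (Eu n × ℝ) × Eu n =>
      Φ ((q.1.1, q.2), q.1.2)) (by fun_prop))]
  have h3 : ∀ s ∈ Ioc (0:ℝ) 1, ∫⁻ h : Eu n, ∫⁻ x : Eu n, Φ ((h, x), s)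
      = (cSph n * ∫⁻ x, ∫⁻ t in Ioi (0:ℝ), g (x, t) ^ p) * ENNReal.ofReal (s ^ (-(1 / p))) := by
    intro s hs
    have := lint_slice hn (f := fun z => ENNReal.ofReal (s ^ (1 - 1 / p)) * g z ^ p)
      (by fun_prop) hs.1 (s / 2)
    simp only [hΦ]
    rw [this]
    have hm1 : Measurable fun x => ∫⁻ t in Ioi (0:ℝ), g (x, t) ^ p :=
      Measurable.lintegral_prod_right' (f := fun z => g z ^ p) (by fun_prop)
    have : ∀ x, ∫⁻ t in Ioi (0:ℝ), ENNReal.ofReal (s ^ (1 - 1 / p)) * g (x, t) ^ p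
      = ENNReal.ofReal (s ^ (1 - 1 / p)) * ∫⁻ t in Ioi (0:ℝ), g (x, t) ^ p := by
      intro x
      rw [lintegral_const_mul _ (by fun_prop)]
    simp_rw [this]
    rw [lintegral_const_mul _ hm1]
    have e : ENNReal.ofReal (s ^ (-(1 / p)))
        = ENNReal.ofReal s⁻¹ * ENNReal.ofReal (s ^ (1 - 1 / p)) := by
      rw [← ENNReal.ofReal_mul (by have := hs.1; positivity), ← Real.rpow_neg_one,
        ← Real.rpow_add hs.1]
      congr 2
      ring
    rw [e]
    ring
  rw [setLIntegral_congr_fun measurableSet_Ioc h3, lintegral_const_mul _ (by fun_prop)]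
  rw [← cI]
  ring

end Assemble


section Main

noncomputable def mC (n : ℕ) (p : ℝ) : ℝ≥0∞ :=
  2 ^ p * (2 ^ p * 2 ^ p) * (cI p ^ (p - 1) + 1) * (cSph n * (cI p + cI p + 1))
    + 2 ^ p * (2 * (cSph n * ENNReal.ofReal (1 / (p - 1)) * 2 ^ p))

lemma mC_ne_top (n : ℕ) {p : ℝ} (hp : 1 < p) : mC n p ≠ ⊤ := by
  have h1 := cSph_ne_top n
  have h2 := cI_ne_top hp
  have h3 : (2:ℝ≥0∞) ^ p ≠ ⊤ := ENNReal.rpow_ne_top_of_nonneg (by linarith) (by norm_num)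
  have h4 : cI p ^ (p - 1) ≠ ⊤ := ENNReal.rpow_ne_top_of_nonneg (by linarith) h2
  unfold mC
  finiteness

lemma near_pt {n : ℕ} {p : ℝ} (hp : 1 < p) {g : Eu n × ℝ → ℝ≥0∞} (hg : Measurable g)
    {W : ℝ≥0∞} {x h : Eu n} (hh : h ≠ 0) {c : ℝ≥0∞}
    (hW : W ≤ ENNReal.ofReal (2 * ‖h‖) *
      ((∫⁻ s in Ioc (0:ℝ) 1, g (x + (s / 2) • h, s * ‖h‖))
      + (∫⁻ s in Ioc (0:ℝ) 1, g ((x + h) + (s / 2) • (-h), s * ‖-h‖)) + c)) :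
    W ^ p * ENNReal.ofReal (‖h‖ ^ (-((n:ℝ) + p - 1)))
      ≤ 2 ^ p * (2 ^ p * 2 ^ p) * (cI p ^ (p - 1) + 1) *
        (ENNReal.ofReal (‖h‖ ^ (1 - (n:ℝ))) * rayN p g x h
        + ENNReal.ofReal (‖h‖ ^ (1 - (n:ℝ))) * rayN p g (x + h) (-h)
        + ENNReal.ofReal (‖h‖ ^ (1 - (n:ℝ))) * c ^ p) := by
  have hp0 : 0 < p := by linarith
  have hr : 0 < ‖h‖ := norm_pos_iff.mpr hh
  have e1 : ENNReal.ofReal (2 * ‖h‖) ^ p * ENNReal.ofReal (‖h‖ ^ (-((n:ℝ) + p - 1)))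
      = 2 ^ p * ENNReal.ofReal (‖h‖ ^ (1 - (n:ℝ))) := by
    rw [ENNReal.ofReal_mul (by norm_num), ENNReal.mul_rpow_of_nonneg _ _ hp0.le, mul_assoc,
      ENNReal.ofReal_rpow_of_pos hr, ← ENNReal.ofReal_mul (by positivity), ← Real.rpow_add hr]
    congr 3
    · simp
    · ring
  have b1 : (∫⁻ s in Ioc (0:ℝ) 1, g (x + (s / 2) • h, s * ‖h‖)) ^ p
      ≤ (cI p ^ (p - 1) + 1) * rayN p g x h :=
    (holder_unit hp (f := fun s => g (x + (s / 2) • h, s * ‖h‖)) (by fun_prop)).trans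
      (by unfold rayN; gcongr; exact le_self_add)
  have b2 : (∫⁻ s in Ioc (0:ℝ) 1, g ((x + h) + (s / 2) • (-h), s * ‖-h‖)) ^ p
      ≤ (cI p ^ (p - 1) + 1) * rayN p g (x + h) (-h) :=
    (holder_unit hp (f := fun s => g ((x + h) + (s / 2) • (-h), s * ‖-h‖)) (by fun_prop)).trans
      (by unfold rayN; gcongr; exact le_self_add)
  have b3 : c ^ p ≤ (cI p ^ (p - 1) + 1) * c ^ p :=
    le_mul_of_one_le_left zero_le le_add_self
  calc W ^ p * ENNReal.ofReal (‖h‖ ^ (-((n:ℝ) + p - 1)))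
      ≤ (ENNReal.ofReal (2 * ‖h‖) *
      ((∫⁻ s in Ioc (0:ℝ) 1, g (x + (s / 2) • h, s * ‖h‖))
      + (∫⁻ s in Ioc (0:ℝ) 1, g ((x + h) + (s / 2) • (-h), s * ‖-h‖)) + c)) ^ p
      * ENNReal.ofReal (‖h‖ ^ (-((n:ℝ) + p - 1))) := by gcongr
    _ = (ENNReal.ofReal (2 * ‖h‖) ^ p * ENNReal.ofReal (‖h‖ ^ (-((n:ℝ) + p - 1)))) *
      ((∫⁻ s in Ioc (0:ℝ) 1, g (x + (s / 2) • h, s * ‖h‖))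
      + (∫⁻ s in Ioc (0:ℝ) 1, g ((x + h) + (s / 2) • (-h), s * ‖-h‖)) + c) ^ p := by
        rw [ENNReal.mul_rpow_of_nonneg _ _ hp0.le]; ring
    _ ≤ (2 ^ p * ENNReal.ofReal (‖h‖ ^ (1 - (n:ℝ)))) * (2 ^ p * 2 ^ p *
        ((cI p ^ (p - 1) + 1) * rayN p g x h + (cI p ^ (p - 1) + 1) * rayN p g (x + h) (-h)
        + (cI p ^ (p - 1) + 1) * c ^ p)) := by
        rw [e1]
        gcongr
        exact (ennreal_add_rpow3 hp _ _ _).trans (by gcongr)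
    _ = _ := by ring

lemma sum_five {α : Type*} [MeasurableSpace α] {μ : Measure α} {f1 f2 f3 f4 f5 : α → ℝ≥0∞}
    (h1 : Measurable f1) (h2 : Measurable f2) (h3 : Measurable f3) (h4 : Measurable f4)
    (h5 : Measurable f5) {a b c : ℝ≥0∞} :
    ∫⁻ q, a * (f1 q + f2 q + b * f3 q) + c * (f4 q + f5 q) ∂μ
      = a * ((∫⁻ q, f1 q ∂μ) + (∫⁻ q, f2 q ∂μ) + b * ∫⁻ q, f3 q ∂μ)
        + c * ((∫⁻ q, f4 q ∂μ) + ∫⁻ q, f5 q ∂μ) := by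
  rw [lintegral_add_left (by fun_prop), lintegral_const_mul _ (by fun_prop),
    lintegral_const_mul _ (by fun_prop), lintegral_add_left (by fun_prop),
    lintegral_add_left (by fun_prop), lintegral_add_left (by fun_prop),
    lintegral_const_mul _ (by fun_prop)]

lemma main_abs {n : ℕ} (hn : 1 ≤ n) {p : ℝ} (hp : 1 < p) {ε : ℝ} (hε : 0 < ε)
    {g v : Eu n × ℝ → ℝ≥0∞} (hg : Measurable g) (hv : Measurable v) {V0 : Eu n → ℝ≥0∞}
    (hV0 : Measurable V0)
    (hV : ∀ x, ∀ t ∈ Ioc (0:ℝ) ε, V0 x ≤ v (x, t) + ∫⁻ s in Ioc (0:ℝ) ε, g (x, s))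
    {W : Eu n → Eu n → ℝ≥0∞}
    (hW : ∀ x h : Eu n, h ≠ 0 → ‖h‖ ≤ ε → W x (x + h) ≤ ENNReal.ofReal (2 * ‖h‖) *
      ((∫⁻ s in Ioc (0:ℝ) 1, g (x + (s / 2) • h, s * ‖h‖))
      + (∫⁻ s in Ioc (0:ℝ) 1, g ((x + h) + (s / 2) • (-h), s * ‖-h‖))
      + ENNReal.ofReal ε⁻¹ * v (x + (1 / 2 : ℝ) • h, ‖h‖)))
    (hWf : ∀ x y, W x y ≤ V0 x + V0 y) :
    ∫⁻ x, ∫⁻ y, W x y ^ p * ENNReal.ofReal (‖x - y‖ ^ (-((n:ℝ) + p - 1)))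
      ≤ mC n p * ((∫⁻ x, ∫⁻ t in Ioi (0:ℝ), g (x, t) ^ p)
        + ENNReal.ofReal ε⁻¹ ^ p * ∫⁻ x, ∫⁻ t in Ioi (0:ℝ), v (x, t) ^ p) := by
  have hp0 : 0 < p := by linarith
  have hn1 : (1:ℝ) ≤ n := by exact_mod_cast hn
  have hT := trace_T hp hε hg hv hV
  set e := ENNReal.ofReal ε⁻¹ with he
  set A := ∫⁻ x, ∫⁻ t in Ioi (0:ℝ), g (x, t) ^ p with hA
  set B := ∫⁻ x, ∫⁻ t in Ioi (0:ℝ), v (x, t) ^ p with hB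
  set T := ∫⁻ x, V0 x ^ p with hTd
  have het : e ≠ ⊤ := ENNReal.ofReal_ne_top
  have hetp : e ^ p ≠ ⊤ := ENNReal.rpow_ne_top_of_nonneg hp0.le het
  have hN := rayN_meas p hg
  have hN' : ∀ {α : Type} [MeasurableSpace α] {a b : α → Eu n}, Measurable a → Measurable b →
      Measurable (fun q => rayN p g (a q) (b q)) := fun ha hb => hN.comp (ha.prodMk hb)
  set k : Eu n → ℝ≥0∞ := fun h => ENNReal.ofReal (‖h‖ ^ (1 - (n:ℝ))) with hk
  have hkm : Measurable k := by fun_prop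
  set fr : Eu n → ℝ≥0∞ := fun h =>
    if ε < ‖h‖ then ENNReal.ofReal (‖h‖ ^ (-((n:ℝ) + p - 1))) else 0 with hfr
  have hfrm : Measurable fr := by
    refine Measurable.ite ?_ (by fun_prop) (by fun_prop)
    exact measurableSet_lt (by fun_prop) (by fun_prop)
  set c1 : ℝ≥0∞ := 2 ^ p * (2 ^ p * 2 ^ p) * (cI p ^ (p - 1) + 1) with hc1
  -- pointwise bound
  have hpt : ∀ x y, W x y ^ p * ENNReal.ofReal (‖x - y‖ ^ (-((n:ℝ) + p - 1)))
      ≤ c1 * (k (y - x) * rayN p g x (y - x) + k (y - x) * rayN p g y (x - y)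
        + e ^ p * (k (y - x) * v (x + (1 / 2 : ℝ) • (y - x), 1 * ‖y - x‖) ^ p))
        + 2 ^ p * (V0 x ^ p * fr (y - x) + V0 y ^ p * fr (y - x)) := by
    intro x y
    rcases eq_or_ne (y - x) 0 with h0 | h0
    · have : x - y = 0 := by rw [← neg_sub, h0, neg_zero]
      rw [this, norm_zero, Real.zero_rpow (by linarith)]
      simp
    · rw [norm_sub_rev x y]
      by_cases hle : ‖y - x‖ ≤ ε
      · refine le_trans ?_ le_self_add
        have h1 := near_pt hp hg h0 (hW x (y - x) h0 hle)
        rw [add_sub_cancel, neg_sub y x] at h1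
        refine h1.trans (le_of_eq ?_)
        rw [ENNReal.mul_rpow_of_nonneg _ _ hp0.le, one_mul]
        simp only [hk, hc1]
        ring
      · refine le_trans ?_ le_add_self
        push Not at hle
        simp only [hfr, if_pos hle]
        rw [← add_mul, ← mul_assoc]
        gcongr
        exact (ENNReal.rpow_le_rpow (hWf x y) hp0.le).trans (ennreal_add_rpow hp _ _)
  refine (lintegral_mono fun x => lintegral_mono fun y => hpt x y).trans ?_
  -- the five integrals
  have I1 : ∫⁻ x, ∫⁻ y, k (y - x) * rayN p g x (y - x) = cSph n * cI p * A := by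
    rw [← rayN_int hn hp hg]
    refine lintegral_congr fun x => ?_
    exact lintegral_sub_right_eq_self (fun h => k h * rayN p g x h) x
  have I2 : ∫⁻ x, ∫⁻ y, k (y - x) * rayN p g y (x - y) = cSph n * cI p * A := by
    rw [lintegral_lintegral_swap (by
      refine Measurable.aemeasurable ?_
      simp only [Function.uncurry_def]
      exact (hkm.comp (by fun_prop)).mul (hN' (by fun_prop) (by fun_prop)))]
    rw [← I1]
    refine lintegral_congr fun x => lintegral_congr fun y => ?_
    simp only [hk]
    rw [norm_sub_rev]
  have I3 : ∫⁻ x, ∫⁻ y, k (y - x) * v (x + (1 / 2 : ℝ) • (y - x), 1 * ‖y - x‖) ^ p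
      = cSph n * B := by
    have h1 : ∀ x, ∫⁻ y, k (y - x) * v (x + (1 / 2 : ℝ) • (y - x), 1 * ‖y - x‖) ^ p
        = ∫⁻ h, k h * v (x + (1 / 2 : ℝ) • h, 1 * ‖h‖) ^ p := fun x =>
      lintegral_sub_right_eq_self (fun h => k h * v (x + (1 / 2 : ℝ) • h, 1 * ‖h‖) ^ p) x
    simp_rw [h1]
    rw [lintegral_lintegral_swap (by
      refine Measurable.aemeasurable ?_
      simp only [Function.uncurry_def]
      fun_prop)]
    have := lint_slice hn (f := fun z => v z ^ p) (by fun_prop) one_pos (1 / 2)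
    simp only [hk]
    rw [this]
    simp [hB]
  have Ifr : ∫⁻ h, fr h = cSph n * ENNReal.ofReal (1 / (p - 1)) * e ^ (p - 1) := by
    rw [hfr, lint_far hn hp hε, mul_assoc]
    congr 1
    rw [he, ENNReal.ofReal_rpow_of_pos (by positivity), ← ENNReal.ofReal_mul (by
      have : 0 < p - 1 := by linarith
      positivity)]
    congr 1
    rw [Real.inv_rpow hε.le, ← Real.rpow_neg hε.le, neg_sub]
    ring
  have I4 : ∫⁻ x, ∫⁻ y, V0 x ^ p * fr (y - x) = T * ∫⁻ h, fr h := by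
    have h1 : ∀ x, ∫⁻ y, V0 x ^ p * fr (y - x) = V0 x ^ p * ∫⁻ h, fr h := by
      intro x
      rw [lintegral_const_mul _ (by fun_prop), lintegral_sub_right_eq_self fr x]
    simp_rw [h1]
    rw [lintegral_mul_const _ (by fun_prop)]
  have I5 : ∫⁻ x, ∫⁻ y, V0 y ^ p * fr (y - x) = T * ∫⁻ h, fr h := by
    rw [lintegral_lintegral_swap (by
      refine Measurable.aemeasurable ?_
      simp only [Function.uncurry_def]
      fun_prop), ← I4]
    refine lintegral_congr fun x => lintegral_congr fun y => ?_
    simp only [hfr]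
    rw [norm_sub_rev]
  -- measurability
  have M1 : Measurable (fun q : Eu n × Eu n => k (q.2 - q.1) * rayN p g q.1 (q.2 - q.1)) :=
    (hkm.comp (by fun_prop)).mul (hN' (by fun_prop) (by fun_prop))
  have M2 : Measurable (fun q : Eu n × Eu n => k (q.2 - q.1) * rayN p g q.2 (q.1 - q.2)) :=
    (hkm.comp (by fun_prop)).mul (hN' (by fun_prop) (by fun_prop))
  have M3 : Measurable (fun q : Eu n × Eu n =>
      k (q.2 - q.1) * v (q.1 + (1 / 2 : ℝ) • (q.2 - q.1), 1 * ‖q.2 - q.1‖) ^ p) := by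
    fun_prop
  have M4 : Measurable (fun q : Eu n × Eu n => V0 q.1 ^ p * fr (q.2 - q.1)) := by fun_prop
  have M5 : Measurable (fun q : Eu n × Eu n => V0 q.2 ^ p * fr (q.2 - q.1)) := by fun_prop
  have toProd : ∀ {f : Eu n × Eu n → ℝ≥0∞}, Measurable f →
      ∫⁻ x, ∫⁻ y, f (x, y) = ∫⁻ q, f q ∂(volume.prod volume) := fun hf =>
    (lintegral_prod _ hf.aemeasurable).symm
  have I1' := (toProd M1).symm.trans I1
  have I2' := (toProd M2).symm.trans I2
  have I3' := (toProd M3).symm.trans I3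
  have I4' := (toProd M4).symm.trans I4
  have I5' := (toProd M5).symm.trans I5
  have hsum := toProd (f := fun q : Eu n × Eu n =>
    c1 * (k (q.2 - q.1) * rayN p g q.1 (q.2 - q.1) + k (q.2 - q.1) * rayN p g q.2 (q.1 - q.2)
        + e ^ p * (k (q.2 - q.1) * v (q.1 + (1 / 2 : ℝ) • (q.2 - q.1), 1 * ‖q.2 - q.1‖) ^ p))
        + 2 ^ p * (V0 q.1 ^ p * fr (q.2 - q.1) + V0 q.2 ^ p * fr (q.2 - q.1)))
    ((((M1.add M2).add (M3.const_mul _)).const_mul _).add ((M4.add M5).const_mul _))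
  refine le_trans (le_of_eq hsum) ?_
  rw [sum_five M1 M2 M3 M4 M5, I1', I2', I3', I4', I5', Ifr]
  have hA1 : A ≤ A + e ^ p * B := le_self_add
  have hB1 : e ^ p * B ≤ A + e ^ p * B := le_add_self
  unfold mC
  rw [add_mul, ← hc1]
  refine add_le_add ?_ ?_
  · calc c1 * (cSph n * cI p * A + cSph n * cI p * A + e ^ p * (cSph n * B))
        = c1 * (cSph n * cI p * A + cSph n * cI p * A + cSph n * (e ^ p * B)) := by ring
      _ ≤ c1 * (cSph n * cI p * (A + e ^ p * B) + cSph n * cI p * (A + e ^ p * B)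
          + cSph n * (A + e ^ p * B)) := by gcongr
      _ = _ := by ring
  · calc 2 ^ p * (T * (cSph n * ENNReal.ofReal (1 / (p - 1)) * e ^ (p - 1))
          + T * (cSph n * ENNReal.ofReal (1 / (p - 1)) * e ^ (p - 1)))
        = 2 ^ p * (2 * (cSph n * ENNReal.ofReal (1 / (p - 1)) * (e ^ (p - 1) * T))) := by ring
      _ ≤ 2 ^ p * (2 * (cSph n * ENNReal.ofReal (1 / (p - 1)) *
          (2 ^ p * (A + e ^ p * B)))) := by gcongr
      _ = _ := by ring

/-- the final form: the two left hand sides -/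
lemma final_abs {n : ℕ} (hn : 1 ≤ n) {p : ℝ} (hp : 1 < p) {β : ℝ} (hβ : 0 < β) {ε : ℝ}
    (hεd : ε = β ^ (-(1 / 2 : ℝ)))
    {g v : Eu n × ℝ → ℝ≥0∞} (hg : Measurable g) (hv : Measurable v) {V0 : Eu n → ℝ≥0∞}
    (hV0 : Measurable V0)
    (hV : ∀ x, ∀ t ∈ Ioc (0:ℝ) ε, V0 x ≤ v (x, t) + ∫⁻ s in Ioc (0:ℝ) ε, g (x, s))
    {W : Eu n → Eu n → ℝ≥0∞}
    (hW : ∀ x h : Eu n, h ≠ 0 → ‖h‖ ≤ ε → W x (x + h) ≤ ENNReal.ofReal (2 * ‖h‖) *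
      ((∫⁻ s in Ioc (0:ℝ) 1, g (x + (s / 2) • h, s * ‖h‖))
      + (∫⁻ s in Ioc (0:ℝ) 1, g ((x + h) + (s / 2) • (-h), s * ‖-h‖))
      + ENNReal.ofReal ε⁻¹ * v (x + (1 / 2 : ℝ) • h, ‖h‖)))
    (hWf : ∀ x y, W x y ≤ V0 x + V0 y) :
    (∫⁻ x, ∫⁻ y, W x y ^ p * ENNReal.ofReal (‖x - y‖ ^ (-((n:ℝ) + p - 1)))) ^ (1 / p)
      + ENNReal.ofReal (β ^ ((p - 1) / (2 * p))) * (∫⁻ x, V0 x ^ p) ^ (1 / p)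
      ≤ (mC n p ^ (1 / p) + 2) * ((∫⁻ x, ∫⁻ t in Ioi (0:ℝ), g (x, t) ^ p) ^ (1 / p)
        + ENNReal.ofReal (β ^ ((1:ℝ) / 2)) *
          (∫⁻ x, ∫⁻ t in Ioi (0:ℝ), v (x, t) ^ p) ^ (1 / p)) := by
  have hp0 : 0 < p := by linarith
  have hε : 0 < ε := by rw [hεd]; positivity
  have h1 := main_abs hn hp hε hg hv hV0 hV hW hWf
  have hT := trace_T hp hε hg hv hV
  have hei : ε⁻¹ = β ^ (1 / 2 : ℝ) := by rw [hεd, ← Real.rpow_neg hβ.le, neg_neg]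
  rw [hei] at h1 hT
  set e := ENNReal.ofReal (β ^ (1 / 2 : ℝ)) with he
  set A := ∫⁻ x, ∫⁻ t in Ioi (0:ℝ), g (x, t) ^ p with hA
  set B := ∫⁻ x, ∫⁻ t in Ioi (0:ℝ), v (x, t) ^ p with hB
  have hX : (A + e ^ p * B) ^ (1 / p) ≤ A ^ (1 / p) + e * B ^ (1 / p) := by
    refine (ENNReal.rpow_add_le_add_rpow A (e ^ p * B) (by positivity)
      (by rw [div_le_one hp0]; exact hp.le)).trans (le_of_eq ?_)
    rw [ENNReal.mul_rpow_of_nonneg _ _ (by positivity), ← ENNReal.rpow_mul,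
      mul_one_div_cancel hp0.ne', ENNReal.rpow_one]
  have e2 : ENNReal.ofReal (β ^ ((p - 1) / (2 * p))) = (e ^ (p - 1)) ^ (1 / p) := by
    rw [he, ← ENNReal.rpow_mul, ENNReal.ofReal_rpow_of_pos (by positivity), ← Real.rpow_mul hβ.le]
    congr 2
    field_simp
  rw [add_mul]
  refine add_le_add ?_ ?_
  · refine (ENNReal.rpow_le_rpow h1 (by positivity)).trans ?_
    rw [ENNReal.mul_rpow_of_nonneg _ _ (by positivity)]
    gcongr
  · rw [e2, ← ENNReal.mul_rpow_of_nonneg _ _ (by positivity)]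
    refine (ENNReal.rpow_le_rpow hT (by positivity)).trans ?_
    rw [ENNReal.mul_rpow_of_nonneg _ _ (by positivity), ← ENNReal.rpow_mul,
      mul_one_div_cancel hp0.ne', ENNReal.rpow_one]
    gcongr

end Main


section Conc

lemma emb_castSucc {n : ℕ} (x : Eu n) (t : ℝ) (i : Fin n) : emb x t i.castSucc = x i := by
  simp [emb]

lemma emb_last {n : ℕ} (x : Eu n) (t : ℝ) : emb x t (Fin.last n) = t := by
  simp [emb]

lemma emb_add {n : ℕ} (x y : Eu n) (s t : ℝ) : emb (x + y) (s + t) = emb x s + emb y t := by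
  ext i
  refine Fin.lastCases ?_ (fun j => ?_) i
  · simp [emb_last]
  · simp [emb_castSucc]

lemma emb_smul {n : ℕ} (c : ℝ) (x : Eu n) (t : ℝ) : emb (c • x) (c * t) = c • emb x t := by
  ext i
  refine Fin.lastCases ?_ (fun j => ?_) i
  · simp [emb_last]
  · simp [emb_castSucc]

lemma emb_sub {n : ℕ} (x y : Eu n) (s t : ℝ) : emb (x - y) (s - t) = emb x s - emb y t := by
  ext i
  refine Fin.lastCases ?_ (fun j => ?_) i
  · simp [emb_last]
  · simp [emb_castSucc]

lemma emb_continuous {n : ℕ} : Continuous (fun z : Eu n × ℝ => emb z.1 z.2) := by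
  unfold emb
  refine (ContinuousLinearEquiv.continuous _).comp ?_
  refine continuous_pi fun i => ?_
  refine Fin.lastCases ?_ (fun j => ?_) i
  · simp only [Fin.snoc_last]; fun_prop
  · simp only [Fin.snoc_castSucc]; fun_prop

lemma emb_norm_le {n : ℕ} (x : Eu n) (t : ℝ) : ‖emb x t‖ ≤ ‖x‖ + |t| := by
  have h : ‖emb x t‖ ^ 2 = ‖x‖ ^ 2 + t ^ 2 := by
    rw [EuclideanSpace.norm_sq_eq, EuclideanSpace.norm_sq_eq, Fin.sum_univ_castSucc]
    simp [emb_last, emb_castSucc]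
  refine abs_le_of_sq_le_sq' ?_ (by positivity) |>.2
  rw [h]
  nlinarith [norm_nonneg x, abs_nonneg t, sq_abs t]

lemma half_convex (n : ℕ) : Convex ℝ (closedHalfSpace n) := by
  intro x hx y hy a b ha hb _
  simp only [closedHalfSpace, mem_setOf_eq] at *
  simp only [PiLp.add_apply, PiLp.smul_apply, smul_eq_mul]
  positivity

lemma emb_mem {n : ℕ} (x : Eu n) {t : ℝ} (ht : 0 ≤ t) : emb x t ∈ closedHalfSpace n := by
  simpa [closedHalfSpace, emb_last] using ht

variable {F : Type*} [NormedAddCommGroup F] [InnerProductSpace ℝ F]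

lemma hsNorm_nonneg {m : ℕ} (T : Eu m →L[ℝ] F) : 0 ≤ hsNorm T := Real.sqrt_nonneg _

lemma hsNorm_apply {m : ℕ} (T : Eu m →L[ℝ] F) (d : Eu m) : ‖T d‖ ≤ hsNorm T * ‖d‖ := by
  have e : d = ∑ i, d i • EuclideanSpace.single i (1:ℝ) := by
    ext j
    simp [Finset.sum_apply, Pi.single_apply]
  calc ‖T d‖ = ‖∑ i, d i • T (EuclideanSpace.single i (1:ℝ))‖ := by
        conv_lhs => rw [e]
        simp only [map_sum, map_smul]
    _ ≤ ∑ i, ‖T (EuclideanSpace.single i (1:ℝ))‖ * ‖d i‖ := by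
        refine (norm_sum_le _ _).trans (le_of_eq ?_)
        refine Finset.sum_congr rfl fun i _ => ?_
        rw [norm_smul, mul_comm]
    _ ≤ hsNorm T * ‖d‖ := by
        rw [EuclideanSpace.norm_eq]
        exact Real.sum_mul_le_sqrt_mul_sqrt _ _ _

lemma hsNorm_continuous {m : ℕ} : Continuous (fun T : Eu m →L[ℝ] F => hsNorm T) := by
  unfold hsNorm
  fun_prop

/-- continuous extension by reflection-free clipping -/
lemma clip_continuous {n : ℕ} {X : Type*} [TopologicalSpace X] {f : Eu (n + 1) → X}
    (hf : ContinuousOn f (closedHalfSpace n)) :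
    Continuous (fun z : Eu n × ℝ => f (emb z.1 (max z.2 0))) := by
  have h : Continuous (fun z : Eu n × ℝ => emb z.1 (max z.2 0)) :=
    emb_continuous.comp (g := fun z : Eu n × ℝ => emb z.1 z.2)
      (f := fun z : Eu n × ℝ => (z.1, max z.2 0)) (by fun_prop)
  exact hf.comp_continuous h (fun z => emb_mem _ (le_max_right _ _))

lemma ofReal_int01 {f : ℝ → ℝ} (hf : Continuous f) (h0 : ∀ s, 0 ≤ f s) {b : ℝ} (hb : 0 ≤ b) :
    ENNReal.ofReal (∫ s in (0:ℝ)..b, f s) = ∫⁻ s in Ioc (0:ℝ) b, ENNReal.ofReal (f s) := by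
  rw [intervalIntegral.integral_of_le hb]
  refine ofReal_integral_eq_lintegral_ofReal ?_ (Filter.Eventually.of_forall h0)
  exact (hf.intervalIntegrable 0 b).1

end Conc


section Fin
variable {F : Type*} [NormedAddCommGroup F] [InnerProductSpace ℝ F]

lemma transport_norm {E : Type*} [NormedAddCommGroup E] [NormedSpace ℝ E]
    {S : Set E} (hS : Convex ℝ S) {Γ : E → E →L[ℝ] F →L[ℝ] F}
    (hskew : ∀ z ∈ S, ∀ v u, ⟪Γ z v u, u⟫ = 0)
    {x y : E} (hx : x ∈ S) (hy : y ∈ S)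
    {P : ℝ → F →L[ℝ] F} (hP1 : P 1 = ContinuousLinearMap.id ℝ F)
    (hP : ∀ t ∈ Icc (0:ℝ) 1, HasDerivWithinAt P
            (-((Γ ((1 - t) • x + t • y)) (y - x)).comp (P t)) (Icc (0:ℝ) 1) t) (v : F) :
    ‖P 0 v‖ ≤ ‖v‖ := by
  have hflip : ∀ v : F, ∀ t ∈ Icc (0:ℝ) 1, HasDerivWithinAt (fun t => P (1 - t) v)
      (-(Γ (y + t • (x - y)) (x - y) (P (1 - t) v))) (Icc (0:ℝ) 1) t := by
    intro v t ht
    have h1t : 1 - t ∈ Icc (0:ℝ) 1 := ⟨by linarith [ht.2], by linarith [ht.1]⟩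
    have h0 := hP (1 - t) h1t
    have h1 := h0.scomp t (h := fun t => 1 - t) (h' := -1) (s := Icc 0 1)
      (((hasDerivAt_id t).const_sub 1).hasDerivWithinAt)
      (fun r hr => ⟨by linarith [hr.2], by linarith [hr.1]⟩)
    have h2 := h1.clm_apply (hasDerivWithinAt_const t (Icc (0:ℝ) 1) v)
    refine h2.congr_deriv ?_
    have e1 : (1 - (1 - t)) • x + (1 - t) • y = y + t • (x - y) := by module
    have e2 : y - x = -(x - y) := by abel
    rw [e1, e2]
    simp
  have := skew_norm_parallel (A := fun t => Γ (y + t • (x - y)) (x - y))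
    (fun t ht v => hskew _ (hS.add_smul_sub_mem hy hx ht) _ _) (hflip v) 1 (by simp)
  simpa [hP1] using this

variable {n : ℕ}

/-- points on the segment from the apex `(c, r)` to the boundary point `(x, 0)` -/
lemma seg_emb (c x : Eu n) (r s : ℝ) :
    emb c r + s • (emb x 0 - emb c r) = emb (x + (1 - s) • (c - x)) ((1 - s) * r) := by
  rw [← emb_sub, ← emb_smul, ← emb_add]
  congr 1
  · module
  · ring

lemma vert_est {Γ : Eu (n + 1) → Eu (n + 1) →L[ℝ] F →L[ℝ] F}
    (hskew : ∀ z ∈ closedHalfSpace n, ∀ v u, ⟪Γ z v u, u⟫ = 0)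
    {U : Eu (n + 1) → F} {DU : Eu (n + 1) → Eu (n + 1) →L[ℝ] F}
    (hU : ∀ z ∈ closedHalfSpace n, HasFDerivWithinAt U (DU z) (closedHalfSpace n) z)
    {G : Eu n × ℝ → ℝ} (hG : Continuous G) (hG0 : ∀ z, 0 ≤ G z)
    (hGd : ∀ x t, 0 ≤ t → ∀ d, ‖(DU (emb x t) + (Γ (emb x t)).flip (U (emb x t))) d‖
      ≤ G (x, t) * ‖d‖)
    (x : Eu n) {ε t : ℝ} (ht : t ∈ Ioc 0 ε) :
    ENNReal.ofReal ‖U (emb x 0)‖ ≤ ENNReal.ofReal ‖U (emb x t)‖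
      + ∫⁻ s in Ioc (0:ℝ) ε, ENNReal.ofReal (G (x, s)) := by
  have ht0 := ht.1
  have hnd : ‖emb x 0 - emb x t‖ ≤ t := by
    rw [← emb_sub]
    refine (emb_norm_le _ _).trans ?_
    simp [abs_of_pos ht0]
  have h := ray_est (half_convex n) hskew hU (a := emb x t) (b := emb x 0)
    (emb_mem x ht0.le) (emb_mem x le_rfl) (u := fun _ => 0)
    (fun s hs => by simpa using hasDerivWithinAt_const s (Icc (0:ℝ) 1) (0:F))
    (m := fun s => G (x, (1 - s) * t) * t) (by fun_prop)
    (fun s hs => by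
      have h1 : 0 ≤ (1 - s) * t := mul_nonneg (by linarith [hs.2]) ht0.le
      rw [seg_emb, sub_self, smul_zero, add_zero]
      refine (hGd x _ h1 _).trans ?_
      exact mul_le_mul_of_nonneg_left hnd (hG0 _))
  simp only [sub_zero] at h
  have e : ∫ s in (0:ℝ)..1, G (x, (1 - s) * t) * t = ∫ s in (0:ℝ)..t, G (x, s) := by
    rw [intervalIntegral.integral_comp_sub_left (fun s => G (x, s * t) * t) 1,
      intervalIntegral.integral_mul_const, mul_comm]
    rw [intervalIntegral.mul_integral_comp_mul_right (f := fun s => G (x, s)) t]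
    simp
  rw [e] at h
  refine (ENNReal.ofReal_le_ofReal h).trans (ENNReal.ofReal_add_le.trans ?_)
  rw [ofReal_int01 (by fun_prop) (fun s => hG0 _) ht0.le]
  gcongr
  exact ht.2

lemma near_est [FiniteDimensional ℝ F] {Γ : Eu (n + 1) → Eu (n + 1) →L[ℝ] F →L[ℝ] F}
    {DΓ : Eu (n + 1) → Eu (n + 1) →L[ℝ] Eu (n + 1) →L[ℝ] F →L[ℝ] F}
    (hΓ : ∀ z ∈ closedHalfSpace n, HasFDerivWithinAt Γ (DΓ z) (closedHalfSpace n) z)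
    (hDΓ : ContinuousOn DΓ (closedHalfSpace n))
    (hskew : ∀ z ∈ closedHalfSpace n, ∀ v u, ⟪Γ z v u, u⟫ = 0) {β : ℝ} (hβ : 0 ≤ β)
    (hK : ∀ z ∈ closedHalfSpace n, ∀ v w, ‖((DΓ z) v) w - ((DΓ z) w) v
            + ((Γ z) v).comp ((Γ z) w) - ((Γ z) w).comp ((Γ z) v)‖ ≤ β * ‖v‖ * ‖w‖)
    {U : Eu (n + 1) → F} {DU : Eu (n + 1) → Eu (n + 1) →L[ℝ] F}
    (hU : ∀ z ∈ closedHalfSpace n, HasFDerivWithinAt U (DU z) (closedHalfSpace n) z)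
    {G : Eu n × ℝ → ℝ} (hG : Continuous G) (hG0 : ∀ z, 0 ≤ G z)
    (hGd : ∀ x t, 0 ≤ t → ∀ d, ‖(DU (emb x t) + (Γ (emb x t)).flip (U (emb x t))) d‖
      ≤ G (x, t) * ‖d‖)
    (x h : Eu n) {ε : ℝ} (hε : 0 < ε) (hβε : β * ε ≤ ε⁻¹) (hh : ‖h‖ ≤ ε)
    {P : ℝ → F →L[ℝ] F} (hP1 : P 1 = ContinuousLinearMap.id ℝ F)
    (hP : ∀ t ∈ Icc (0:ℝ) 1, HasDerivWithinAt P
            (-((Γ (emb ((1 - t) • x + t • (x + h)) 0)) (emb (x + h - x) 0)).comp (P t))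
            (Icc (0:ℝ) 1) t) :
    ENNReal.ofReal ‖U (emb x 0) - P 0 (U (emb (x + h) 0))‖ ≤ ENNReal.ofReal (2 * ‖h‖) *
      ((∫⁻ s in Ioc (0:ℝ) 1, ENNReal.ofReal (G (x + (s / 2) • h, s * ‖h‖)))
      + (∫⁻ s in Ioc (0:ℝ) 1, ENNReal.ofReal (G ((x + h) + (s / 2) • (-h), s * ‖-h‖)))
      + ENNReal.ofReal ε⁻¹ * ENNReal.ofReal ‖U (emb (x + (1 / 2 : ℝ) • h) ‖h‖)‖) := by
  set r := ‖h‖ with hr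
  have hr0 : 0 ≤ r := norm_nonneg h
  set c := x + (1 / 2 : ℝ) • h with hc
  have cx : c - x = (1 / 2 : ℝ) • h := by rw [hc]; module
  have cy : c - (x + h) = (1 / 2 : ℝ) • (-h) := by rw [hc]; module
  have n1 : ‖emb x 0 - emb c r‖ ≤ 2 * r := by
    rw [← emb_sub]
    refine (emb_norm_le _ _).trans ?_
    rw [norm_sub_rev, cx, norm_smul, zero_sub, abs_neg, abs_of_nonneg hr0, ← hr]
    norm_num
    linarith
  have n2 : ‖emb (x + h) 0 - emb c r‖ ≤ 2 * r := by
    rw [← emb_sub]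
    refine (emb_norm_le _ _).trans ?_
    rw [norm_sub_rev, cy, norm_smul, zero_sub, abs_neg, abs_of_nonneg hr0, norm_neg, ← hr]
    norm_num
    linarith
  have n3 : ∀ t ∈ Icc (0:ℝ) 1, ‖emb (x + h) 0 + t • (emb x 0 - emb (x + h) 0) - emb c r‖
      ≤ 2 * r := by
    intro t ht
    have e : emb (x + h) 0 + t • (emb x 0 - emb (x + h) 0) - emb c r
        = emb ((1 / 2 - t) • h) (-r) := by
      rw [← emb_sub, ← emb_smul, ← emb_add, ← emb_sub]
      congr 1
      · rw [hc]; module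
      · ring
    rw [e]
    refine (emb_norm_le _ _).trans ?_
    rw [norm_smul, abs_neg, abs_of_nonneg hr0, ← hr, Real.norm_eq_abs]
    have : |1 / 2 - t| ≤ 1 := by
      rw [abs_le]; constructor <;> linarith [ht.1, ht.2]
    nlinarith
  have n4 : ‖emb x 0 - emb (x + h) 0‖ ≤ r := by
    rw [← emb_sub]
    refine (emb_norm_le _ _).trans ?_
    simp [hr]
  have key := triangle_est (half_convex n) hΓ hDΓ hskew hβ hK hU (a := emb c r) (x := emb x 0)
    (y := emb (x + h) 0) (emb_mem _ hr0) (emb_mem _ le_rfl) (emb_mem _ le_rfl) n3 hP1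
    (fun t ht => by
      refine (hP t ht).congr_deriv ?_
      have e1 : (1 - t) • emb x 0 + t • emb (x + h) 0 = emb ((1 - t) • x + t • (x + h)) 0 := by
        rw [← emb_smul, ← emb_smul, ← emb_add]; simp
      have e2 : emb (x + h) 0 - emb x 0 = emb (x + h - x) 0 := by
        rw [← emb_sub]; simp
      rw [e1, e2])
    (m₁ := fun s => 2 * r * G (x + ((1 - s) / 2) • h, (1 - s) * r))
    (m₂ := fun s => 2 * r * G ((x + h) + ((1 - s) / 2) • (-h), (1 - s) * r))
    (by fun_prop) (by fun_prop)
    (fun s hs => by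
      have h1 : 0 ≤ (1 - s) * r := mul_nonneg (by linarith [hs.2]) hr0
      have e : (1 - s) • (c - x) = ((1 - s) / 2) • h := by rw [cx]; module
      rw [seg_emb, e]
      refine (hGd _ _ h1 _).trans ?_
      rw [mul_comm]
      exact mul_le_mul_of_nonneg_right n1 (hG0 _))
    (fun s hs => by
      have h1 : 0 ≤ (1 - s) * r := mul_nonneg (by linarith [hs.2]) hr0
      have e : (1 - s) • (c - (x + h)) = ((1 - s) / 2) • (-h) := by rw [cy]; module
      rw [seg_emb, e]
      refine (hGd _ _ h1 _).trans ?_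
      rw [mul_comm]
      exact mul_le_mul_of_nonneg_right n2 (hG0 _))
  rw [intervalIntegral.integral_const_mul, intervalIntegral.integral_const_mul,
    intervalIntegral.integral_comp_sub_left (fun s => G (x + (s / 2) • h, s * r)) 1,
    intervalIntegral.integral_comp_sub_left (fun s => G ((x + h) + (s / 2) • (-h), s * r)) 1]
    at key
  simp only [sub_self, sub_zero] at key
  have k3 : β * (2 * r) * ‖emb x 0 - emb (x + h) 0‖ * ‖U (emb c r)‖
      ≤ 2 * r * (ε⁻¹ * ‖U (emb c r)‖) := by
    have : β * ‖emb x 0 - emb (x + h) 0‖ ≤ ε⁻¹ :=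
      (mul_le_mul_of_nonneg_left (n4.trans hh) hβ).trans hβε
    calc β * (2 * r) * ‖emb x 0 - emb (x + h) 0‖ * ‖U (emb c r)‖
        = 2 * r * ((β * ‖emb x 0 - emb (x + h) 0‖) * ‖U (emb c r)‖) := by ring
      _ ≤ _ := by gcongr
  have key2 : ‖U (emb x 0) - P 0 (U (emb (x + h) 0))‖ ≤ 2 * r *
      ((∫ s in (0:ℝ)..1, G (x + (s / 2) • h, s * r))
      + (∫ s in (0:ℝ)..1, G ((x + h) + (s / 2) • (-h), s * r)) + ε⁻¹ * ‖U (emb c r)‖) := by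
    linarith
  refine (ENNReal.ofReal_le_ofReal key2).trans ?_
  rw [ENNReal.ofReal_mul (by positivity), norm_neg, ← hr]
  gcongr
  refine ENNReal.ofReal_add_le.trans (add_le_add (ENNReal.ofReal_add_le.trans ?_) (le_of_eq ?_))
  · rw [ofReal_int01 (by fun_prop) (fun s => hG0 _) zero_le_one,
      ofReal_int01 (by fun_prop) (fun s => hG0 _) zero_le_one]
  · rw [ENNReal.ofReal_mul (by positivity)]

end Fin
/-- Theorem 1(i). Gauge-covariant trace estimate on the half-space:
`‖U(·,0)‖_{W^{1-1/p,p}_{Γ∥}} + β^{(p-1)/2p} ‖U(·,0)‖_{Lᵖ}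
  ≤ C (‖D_Γ U‖_{Lᵖ} + β^{1/2} ‖U‖_{Lᵖ})`. -/
theorem trace_estimate_theorem1_i
    {F : Type*} [NormedAddCommGroup F] [InnerProductSpace ℝ F] [FiniteDimensional ℝ F]
    (n : ℕ) (hn : 1 ≤ n) (p : ℝ) (hp1 : 1 < p) :
    ∃ C : ℝ, 0 < C ∧
      ∀ (Γ : EuclideanSpace ℝ (Fin (n + 1)) →
          EuclideanSpace ℝ (Fin (n + 1)) →L[ℝ] F →L[ℝ] F)
        (DΓ : EuclideanSpace ℝ (Fin (n + 1)) →
          EuclideanSpace ℝ (Fin (n + 1)) →L[ℝ] EuclideanSpace ℝ (Fin (n + 1)) →L[ℝ] F →L[ℝ] F),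
        -- Γ of class C¹ on the closed half-space, with skew-adjoint values
        (∀ z ∈ closedHalfSpace n, HasFDerivWithinAt Γ (DΓ z) (closedHalfSpace n) z) →
        ContinuousOn Γ (closedHalfSpace n) →
        ContinuousOn DΓ (closedHalfSpace n) →
        (∀ z ∈ closedHalfSpace n, ∀ (v : EuclideanSpace ℝ (Fin (n + 1))) (u w : F),
          ⟪(Γ z v) u, w⟫ = -⟪u, (Γ z v) w⟫) →
        -- β > 0 bounds the curvature K_Γ on the closed half-space
        ∀ β : ℝ, 0 < β →
        (∀ z ∈ closedHalfSpace n, ∀ v w : EuclideanSpace ℝ (Fin (n + 1)),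
          ‖((DΓ z) v) w - ((DΓ z) w) v
            + ((Γ z) v).comp ((Γ z) w) - ((Γ z) w).comp ((Γ z) v)‖ ≤ β * ‖v‖ * ‖w‖) →
        -- U of class C¹ with compact support on the closed half-space
        ∀ (U : EuclideanSpace ℝ (Fin (n + 1)) → F)
          (DU : EuclideanSpace ℝ (Fin (n + 1)) → EuclideanSpace ℝ (Fin (n + 1)) →L[ℝ] F),
        (∀ z ∈ closedHalfSpace n, HasFDerivWithinAt U (DU z) (closedHalfSpace n) z) →
        ContinuousOn DU (closedHalfSpace n) →
        HasCompactSupport U →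
        -- Rt x y is the parallel transport R^{Γ∥}(x,y) along the boundary segment
        ∀ Rt : EuclideanSpace ℝ (Fin n) → EuclideanSpace ℝ (Fin n) → F →L[ℝ] F,
        (∀ x y : EuclideanSpace ℝ (Fin n), ∃ P : ℝ → F →L[ℝ] F,
          P 1 = ContinuousLinearMap.id ℝ F ∧
          (∀ t ∈ Icc (0:ℝ) 1, HasDerivWithinAt P
            (-((Γ (emb ((1 - t) • x + t • y) 0)) (emb (y - x) 0)).comp (P t))
            (Icc (0:ℝ) 1) t) ∧
          Rt x y = P 0) →
        (∫⁻ x : EuclideanSpace ℝ (Fin n), ∫⁻ y : EuclideanSpace ℝ (Fin n),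
            ENNReal.ofReal (‖U (emb x 0) - (Rt x y) (U (emb y 0))‖ ^ p
              / ‖x - y‖ ^ ((n : ℝ) + p - 1))) ^ (1 / p)
          + ENNReal.ofReal (β ^ ((p - 1) / (2 * p))) *
            (∫⁻ x : EuclideanSpace ℝ (Fin n),
              ENNReal.ofReal (‖U (emb x 0)‖ ^ p)) ^ (1 / p)
        ≤ ENNReal.ofReal C *
            ((∫⁻ x : EuclideanSpace ℝ (Fin n), ∫⁻ t in Ioi (0:ℝ),
                ENNReal.ofReal
                  (hsNorm (DU (emb x t) + (Γ (emb x t)).flip (U (emb x t))) ^ p)) ^ (1 / p)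
              + ENNReal.ofReal (β ^ ((1 : ℝ) / 2)) *
                (∫⁻ x : EuclideanSpace ℝ (Fin n), ∫⁻ t in Ioi (0:ℝ),
                  ENNReal.ofReal (‖U (emb x t)‖ ^ p)) ^ (1 / p)) := by
  have hp0 : 0 < p := by linarith
  refine ⟨(mC n p ^ (1 / p) + 2).toReal, ?_, ?_⟩
  · refine ENNReal.toReal_pos (by simp) ?_
    have := ENNReal.rpow_ne_top_of_nonneg (y := 1 / p) (by positivity) (mC_ne_top n hp1)
    finiteness
  intro Γ DΓ hΓ hΓc hDΓ hskew0 β hβ hK U DU hU hDU _ Rt hRt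
  have hskew : ∀ z ∈ closedHalfSpace n, ∀ v u, ⟪Γ z v u, u⟫ = 0 := by
    intro z hz v u
    have h := hskew0 z hz v u u
    rw [real_inner_comm] at h
    have h2 : ⟪u, Γ z v u⟫ = 0 := by linarith
    rw [real_inner_comm]; exact h2
  have hfin : mC n p ^ (1 / p) + 2 ≠ ⊤ := by
    have := ENNReal.rpow_ne_top_of_nonneg (y := 1 / p) (by positivity) (mC_ne_top n hp1)
    finiteness
  rw [ENNReal.ofReal_toReal hfin]
  have hUc : ContinuousOn U (closedHalfSpace n) := fun z hz => (hU z hz).continuousWithinAt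
  set G0 : Eu (n + 1) → ℝ := fun z => hsNorm (DU z + (Γ z).flip (U z)) with hG0d
  have hflipc : ContinuousOn (fun z => (Γ z).flip (U z)) (closedHalfSpace n) := by
    have h1 : ContinuousOn (fun z => (Γ z).flip) (closedHalfSpace n) :=
      (ContinuousLinearMap.flipₗᵢ ℝ (Eu (n + 1)) F F).continuous.comp_continuousOn hΓc
    exact h1.clm_apply hUc
  have hG0c : ContinuousOn G0 (closedHalfSpace n) :=
    hsNorm_continuous.comp_continuousOn (hDU.add hflipc)
  set G : Eu n × ℝ → ℝ := fun z => G0 (emb z.1 (max z.2 0)) with hGd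
  have hG : Continuous G := clip_continuous hG0c
  have hGn : ∀ z, 0 ≤ G z := fun z => hsNorm_nonneg _
  have hGb : ∀ x t, 0 ≤ t → ∀ d, ‖(DU (emb x t) + (Γ (emb x t)).flip (U (emb x t))) d‖
      ≤ G (x, t) * ‖d‖ := by
    intro x t ht d
    simp only [hGd, hG0d, max_eq_left ht]
    exact hsNorm_apply _ _
  set v : Eu n × ℝ → ℝ := fun z => ‖U (emb z.1 (max z.2 0))‖ with hvd
  have hv : Continuous v := (clip_continuous hUc).norm
  have hvn : ∀ z, 0 ≤ v z := fun z => norm_nonneg _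
  set ε : ℝ := β ^ (-(1 / 2 : ℝ)) with hε
  have hε0 : 0 < ε := by positivity
  have hβε : β * ε ≤ ε⁻¹ := by
    refine le_of_eq ?_
    rw [hε, ← Real.rpow_neg hβ.le]
    nth_rewrite 1 [← Real.rpow_one β]
    rw [← Real.rpow_add hβ]
    norm_num
  have hV0 : Measurable (fun x : Eu n => ENNReal.ofReal ‖U (emb x 0)‖) := by
    have h := hv.comp (f := fun x : Eu n => (x, (0:ℝ))) (by fun_prop)
    simp only [hvd, Function.comp_def, max_self] at h
    exact h.measurable.ennreal_ofReal
  have main := final_abs hn hp1 hβ hε (g := fun z => ENNReal.ofReal (G z))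
    (v := fun z => ENNReal.ofReal (v z)) hG.measurable.ennreal_ofReal hv.measurable.ennreal_ofReal
    hV0
    (fun x t ht => by
      have h := vert_est hskew hU hG hGn hGb x ht
      simpa only [hvd, max_eq_left ht.1.le] using h)
    (W := fun x y => ENNReal.ofReal ‖U (emb x 0) - (Rt x y) (U (emb y 0))‖)
    (fun x h h0 hh => by
      obtain ⟨P, hP1, hP, hPR⟩ := hRt x (x + h)
      have := near_est hΓ hDΓ hskew hβ.le hK hU hG hGn hGb x h hε0 hβε hh hP1 hP
      simp only [hPR, hvd, max_eq_left (norm_nonneg h)]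
      exact this)
    (fun x y => by
      obtain ⟨P, hP1, hP, hPR⟩ := hRt x y
      rw [← ENNReal.ofReal_add (norm_nonneg _) (norm_nonneg _)]
      refine ENNReal.ofReal_le_ofReal ((norm_sub_le _ _).trans ?_)
      gcongr
      rw [hPR]
      refine transport_norm (half_convex n) hskew (emb_mem x le_rfl) (emb_mem y le_rfl) hP1
        (fun t ht => ?_) _
      refine (hP t ht).congr_deriv ?_
      have e1 : (1 - t) • emb x 0 + t • emb y 0 = emb ((1 - t) • x + t • y) 0 := by
        rw [← emb_smul, ← emb_smul, ← emb_add]; simp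
      have e2 : emb y 0 - emb x 0 = emb (y - x) 0 := by
        rw [← emb_sub]; simp
      rw [e1, e2])
  have E1 : ∀ x y : Eu n, ENNReal.ofReal (‖U (emb x 0) - (Rt x y) (U (emb y 0))‖ ^ p
        / ‖x - y‖ ^ ((n : ℝ) + p - 1))
      = ENNReal.ofReal ‖U (emb x 0) - (Rt x y) (U (emb y 0))‖ ^ p *
        ENNReal.ofReal (‖x - y‖ ^ (-((n:ℝ) + p - 1))) := by
    intro x y
    rw [ENNReal.ofReal_rpow_of_nonneg (norm_nonneg _) hp0.le,
      ← ENNReal.ofReal_mul (by positivity), Real.rpow_neg (norm_nonneg _), div_eq_mul_inv]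
  have E2 : ∀ x : Eu n, ENNReal.ofReal (‖U (emb x 0)‖ ^ p)
      = ENNReal.ofReal ‖U (emb x 0)‖ ^ p := fun x =>
    (ENNReal.ofReal_rpow_of_nonneg (norm_nonneg _) hp0.le).symm
  have E3 : ∀ x : Eu n, ∫⁻ t in Ioi (0:ℝ), ENNReal.ofReal
        (hsNorm (DU (emb x t) + (Γ (emb x t)).flip (U (emb x t))) ^ p)
      = ∫⁻ t in Ioi (0:ℝ), ENNReal.ofReal (G (x, t)) ^ p := by
    intro x
    refine setLIntegral_congr_fun measurableSet_Ioi (fun t ht => ?_)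
    rw [ENNReal.ofReal_rpow_of_nonneg (hGn _) hp0.le]
    simp only [hGd, hG0d, max_eq_left (le_of_lt (mem_Ioi.mp ht))]
  have E4 : ∀ x : Eu n, ∫⁻ t in Ioi (0:ℝ), ENNReal.ofReal (‖U (emb x t)‖ ^ p)
      = ∫⁻ t in Ioi (0:ℝ), ENNReal.ofReal (v (x, t)) ^ p := by
    intro x
    refine setLIntegral_congr_fun measurableSet_Ioi (fun t ht => ?_)
    rw [ENNReal.ofReal_rpow_of_nonneg (hvn _) hp0.le]
    simp only [hvd, max_eq_left (le_of_lt (mem_Ioi.mp ht))]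
  simp_rw [E1, E2, E3, E4]
  exact main
end

section
/- Let n ≥ 1, 0 < s < 1, 1 ≤ p < ∞, let F be a finite-dimensional real inner product space, and let Γ∥ : ℝⁿ → L(ℝⁿ, o(F)) be a continuous connection form. Let u : ℝⁿ → F be measurable with ∫_{ℝⁿ} ‖u‖^p < ∞ and with finite gauge-covariant Gagliardo seminorm [u]^p := ∬_{ℝⁿ×ℝⁿ} ‖u(x) − R^{Γ∥}(x,y) u(y)‖^p / |x−y|^{n+sp} dx dy < ∞. Then for every ε > 0 there exists a smooth compactly supported map φ : ℝⁿ → F such that ∫_{ℝⁿ} ‖u − φ‖^p + ∬_{ℝⁿ×ℝⁿ} ‖(u−φ)(x) − R^{Γ∥}(x,y)(u−φ)(y)‖^p / |x−y|^{n+sp} dx dy < ε. (Density of C∞_c(ℝⁿ,F) in the fractional gauge-covariant Sobolev space W^{s,p}_{Γ∥}(ℝⁿ,F).) -/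
set_option synthInstance.maxHeartbeats 1000000
set_option maxHeartbeats 1000000
set_option linter.unusedSectionVars false

open Set MeasureTheory
open scoped RealInnerProductSpace ENNReal
open Filter Topology

section Transport
variable {E F : Type*} [NormedAddCommGroup E] [NormedSpace ℝ E]
  [NormedAddCommGroup F] [InnerProductSpace ℝ F]

lemma aux_path_norm {A : ℝ → F →L[ℝ] F} {P : ℝ → F →L[ℝ] F}
    (hA : ∀ t u w, ⟪(A t) u, w⟫ = -⟪u, (A t) w⟫)
    (h1 : P 1 = ContinuousLinearMap.id ℝ F)
    (hP : ∀ t ∈ Icc (0:ℝ) 1, HasDerivWithinAt P (-(A t).comp (P t)) (Icc (0:ℝ) 1) t)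
    (w : F) {t : ℝ} (ht : t ∈ Icc (0:ℝ) 1) : ‖P t w‖ = ‖w‖ := by
  have hd : ∀ t ∈ Icc (0:ℝ) 1, HasDerivWithinAt (fun t => P t w) (-(A t (P t w))) (Icc (0:ℝ) 1) t := by
    intro t ht
    have := (hP t ht).clm_apply (hasDerivWithinAt_const t (Icc (0:ℝ) 1) w)
    simpa using this
  have hd2 : ∀ t ∈ Icc (0:ℝ) 1,
      HasDerivWithinAt (fun t => ⟪P t w, P t w⟫) 0 (Icc (0:ℝ) 1) t := by
    intro t ht
    have := (hd t ht).inner ℝ (hd t ht)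
    have h0 := hA t (P t w) (P t w)
    have h00 : ⟪P t w, -(A t (P t w))⟫ + ⟪-(A t (P t w)), P t w⟫ = 0 := by
      rw [inner_neg_left, inner_neg_right, h0]; ring
    rw [h00] at this
    exact this
  have := Convex.norm_image_sub_le_of_norm_hasDerivWithin_le (C := 0) hd2 (by simp)
    (convex_Icc 0 1) ht (right_mem_Icc.2 zero_le_one)
  simp only [zero_mul, norm_le_zero_iff, h1, ContinuousLinearMap.id_apply,
    real_inner_self_eq_norm_sq] at this
  have h2 : ‖w‖ ^ 2 = ‖P t w‖ ^ 2 := by linarith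
  exact ((sq_eq_sq₀ (norm_nonneg _) (norm_nonneg _)).1 h2).symm

lemma aux_transport
    (Γ : E → E →L[ℝ] F →L[ℝ] F)
    (hskew : ∀ (x v : E) (u w : F), ⟪(Γ x v) u, w⟫ = -⟪u, (Γ x v) w⟫)
    (Rt : E → E → F →L[ℝ] F)
    (hRt : ∀ x y : E, ∃ P : ℝ → F →L[ℝ] F,
      P 1 = ContinuousLinearMap.id ℝ F ∧
      (∀ t ∈ Icc (0:ℝ) 1, HasDerivWithinAt P
        (-((Γ ((1 - t) • x + t • y)) (y - x)).comp (P t)) (Icc (0:ℝ) 1) t) ∧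
      Rt x y = P 0) (x y : E) (w : F) :
    ‖Rt x y w‖ = ‖w‖ ∧ ∀ M : ℝ, 
      (∀ t ∈ Icc (0:ℝ) 1, ‖Γ ((1 - t) • x + t • y)‖ ≤ M) → 
      ‖w - Rt x y w‖ ≤ M * ‖x - y‖ * ‖w‖ := by
  obtain ⟨P, h1, hP, h0⟩ := hRt x y
  have hn : ∀ t ∈ Icc (0:ℝ) 1, ‖P t w‖ = ‖w‖ := fun t ht => 
    aux_path_norm (A := fun t => Γ ((1 - t) • x + t • y) (y - x)) (fun t u w => hskew _ _ u w) h1 hP w ht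
  rw [h0]
  refine ⟨hn 0 (by simp), fun M hM => ?_⟩
  have hd : ∀ t ∈ Icc (0:ℝ) 1, HasDerivWithinAt (fun t => P t w) 
      (-(Γ ((1 - t) • x + t • y) (y - x) (P t w))) (Icc (0:ℝ) 1) t := by
    intro t ht
    have := (hP t ht).clm_apply (hasDerivWithinAt_const t (Icc (0:ℝ) 1) w)
    simpa using this
  have := Convex.norm_image_sub_le_of_norm_hasDerivWithin_le (C := M * ‖x - y‖ * ‖w‖) hd (by
    intro t ht
    rw [norm_neg]
    calc _ ≤ ‖Γ ((1 - t) • x + t • y) (y - x)‖ * ‖P t w‖ := ContinuousLinearMap.le_opNorm _ _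
      _ ≤ (‖Γ ((1 - t) • x + t • y)‖ * ‖y - x‖) * ‖P t w‖ := by
        gcongr; exact ContinuousLinearMap.le_opNorm _ _
      _ ≤ _ := by rw [hn t ht, norm_sub_rev y x]; gcongr; exact hM t ht)
    (convex_Icc 0 1) (left_mem_Icc.2 zero_le_one) (right_mem_Icc.2 zero_le_one)
  simpa [h1] using this

end Transport

section Kernel
variable {E : Type*} [NormedAddCommGroup E] [NormedSpace ℝ E] [FiniteDimensional ℝ E] [Nontrivial E]
  [MeasurableSpace E] [BorelSpace E] (μ : Measure E) [μ.IsAddHaarMeasure]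

lemma aux_kernel (s p : ℝ) (hs0 : 0 < s) (hs1 : s < 1) (hp : 1 ≤ p) :
    ∫⁻ z, (min 1 ‖z‖ₑ) ^ p * ENNReal.ofReal ((‖z‖ ^ ((Module.finrank ℝ E : ℝ) + s * p))⁻¹) ∂μ < ⊤ := by
  have hd : 1 ≤ Module.finrank ℝ E := Module.finrank_pos
  set d := Module.finrank ℝ E with hdd
  have hint : Integrable (fun z : E => (fun r : ℝ => (min 1 r) ^ p * (r ^ ((d : ℝ) + s * p))⁻¹) ‖z‖) μ := by
    refine (integrable_fun_norm_addHaar μ (f := fun r : ℝ => (min 1 r) ^ p * (r ^ ((d : ℝ) + s * p))⁻¹)).2 ?_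
    rw [← hdd, ← Ioc_union_Ioi_eq_Ioi zero_le_one]
    refine IntegrableOn.union ?_ ?_
    · have : IntegrableOn (fun r : ℝ => r ^ (p * (1 - s) - 1)) (Ioc 0 1) := by
        have := (intervalIntegral.intervalIntegrable_rpow' (a := 0) (b := 1) (r := p * (1 - s) - 1) (by nlinarith))
        rwa [intervalIntegrable_iff_integrableOn_Ioc_of_le zero_le_one] at this
      refine this.congr_fun (fun r hr => ?_) measurableSet_Ioc
      have hr0 : 0 < r := hr.1
      simp only [smul_eq_mul]
      rw [min_eq_right hr.2, ← Real.rpow_neg hr0.le, ← Real.rpow_natCast, ← Real.rpow_add hr0,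
        ← Real.rpow_add hr0]
      congr 1
      push_cast [hd]; ring
    · have : IntegrableOn (fun r : ℝ => r ^ (- 1 - s * p)) (Ioi 1) := 
        integrableOn_Ioi_rpow_of_lt (by nlinarith) one_pos
      refine this.congr_fun (fun r hr => ?_) measurableSet_Ioi
      have hr0 : 0 < r := one_pos.trans hr
      simp only [smul_eq_mul]
      rw [min_eq_left (le_of_lt hr), Real.one_rpow, one_mul, ← Real.rpow_neg hr0.le, ← Real.rpow_natCast,
        ← Real.rpow_add hr0]
      congr 1
      push_cast [hd]; ring
  have h2 := hint.lintegral_lt_top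
  refine lt_of_eq_of_lt (lintegral_congr fun z => ?_) h2
  simp only
  rw [ENNReal.ofReal_mul (by positivity), ← ENNReal.ofReal_rpow_of_nonneg (by positivity) (by linarith),
    ENNReal.ofReal_min, ENNReal.ofReal_one, ofReal_norm]
end Kernel

section Translation
variable {G F : Type*} [NormedAddCommGroup G] [NormedSpace ℝ G] [FiniteDimensional ℝ G]
  [MeasurableSpace G] [BorelSpace G] (μ : Measure G) [μ.IsAddHaarMeasure]
  [NormedAddCommGroup F] [NormedSpace ℝ F] [FiniteDimensional ℝ F] [MeasurableSpace F] [BorelSpace F]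

lemma aux_memLp {p : ℝ} (hp : 1 ≤ p) {g : G → F} (hg : Measurable g)
    (h : ∫⁻ x, ‖g x‖ₑ ^ p ∂μ < ⊤) : MemLp g (ENNReal.ofReal p) μ := by
  refine ⟨hg.aestronglyMeasurable, ?_⟩
  rw [eLpNorm_lt_top_iff_lintegral_rpow_enorm_lt_top (by simp; linarith) (by simp),
    ENNReal.toReal_ofReal (by linarith)]
  exact h

lemma aux_translation {p : ℝ} (hp : 1 ≤ p) {g : G → F} (hg : Measurable g)
    (h : ∫⁻ x, ‖g x‖ₑ ^ p ∂μ < ⊤) :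
    Tendsto (fun z => ∫⁻ x, ‖g x - g (x - z)‖ₑ ^ p ∂μ) (𝓝 0) (𝓝 0) := by
  have hL := aux_memLp μ hp hg h
  have : Fact (1 ≤ ENNReal.ofReal p) := ⟨by simpa using hp⟩
  have : Fact (ENNReal.ofReal p ≠ ⊤) := ⟨by simp⟩
  set f := hL.toLp g with hf
  have hc : Continuous (fun z : G => (DomAddAct.mk (-z)) +ᵥ f) := by
    have h1 : Continuous (fun z : G => DomAddAct.mk (-z)) :=
      DomAddAct.continuous_mk.comp continuous_neg
    exact h1.vadd continuous_const
  have hc2 : Tendsto (fun z : G => edist f ((DomAddAct.mk (-z)) +ᵥ f)) (𝓝 0) (𝓝 0) := by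
    have := (continuous_const (y := f)).edist hc |>.tendsto 0
    simpa using this
  have hc3 := hc2.ennrpow_const p
  rw [ENNReal.zero_rpow_of_pos (by linarith)] at hc3
  refine hc3.congr fun z => ?_
  rw [hf, DomAddAct.mk_vadd_toLp, Lp.edist_toLp_toLp, eLpNorm_eq_lintegral_rpow_enorm_toReal (by simp; linarith) (by simp),
    ENNReal.toReal_ofReal (by linarith), ← ENNReal.rpow_mul, one_div, inv_mul_cancel₀ (by linarith), ENNReal.rpow_one]
  refine lintegral_congr fun x => ?_
  simp [sub_eq_add_neg, add_comm]

end Translation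

section Mollify
variable {E F : Type*} [NormedAddCommGroup E] [NormedSpace ℝ E] [FiniteDimensional ℝ E]
  [MeasurableSpace E] [BorelSpace E] (μ : Measure E) [μ.IsAddHaarMeasure]
  [NormedAddCommGroup F] [NormedSpace ℝ F] [FiniteDimensional ℝ F] [MeasurableSpace F] [BorelSpace F]

lemma aux_jensen {T : Type*} [MeasurableSpace T] (P : Measure T) [IsProbabilityMeasure P]
    {p : ℝ} (hp : 1 ≤ p) {f : T → F} (hf : Measurable f) :
    ‖∫ t, f t ∂P‖ₑ ^ p ≤ ∫⁻ t, ‖f t‖ₑ ^ p ∂P := by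
  have h1 : ‖∫ t, f t ∂P‖ₑ ≤ eLpNorm f (ENNReal.ofReal p) P := by
    refine (enorm_integral_le_lintegral_enorm f).trans ?_
    rw [← eLpNorm_one_eq_lintegral_enorm]
    exact eLpNorm_le_eLpNorm_of_exponent_le (by simpa using hp) hf.aestronglyMeasurable
  rw [eLpNorm_eq_lintegral_rpow_enorm_toReal (by simp; linarith) (by simp),
    ENNReal.toReal_ofReal (by linarith)] at h1
  refine (ENNReal.rpow_le_rpow h1 (by linarith)).trans ?_
  rw [← ENNReal.rpow_mul, one_div, inv_mul_cancel₀ (by linarith), ENNReal.rpow_one]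

lemma aux_average {X T : Type*} [MeasurableSpace X] [MeasurableSpace T]
    (ν : Measure X) [SFinite ν] (P : Measure T) [IsProbabilityMeasure P]
    {p : ℝ} (hp : 1 ≤ p) {h : X → T → F} (hh : Measurable (Function.uncurry h)) {η : ℝ≥0∞}
    (hη : ∀ᵐ t ∂P, ∫⁻ x, ‖h x t‖ₑ ^ p ∂ν ≤ η) :
    ∫⁻ x, ‖∫ t, h x t ∂P‖ₑ ^ p ∂ν ≤ η := by
  calc ∫⁻ x, ‖∫ t, h x t ∂P‖ₑ ^ p ∂ν ≤ ∫⁻ x, ∫⁻ t, ‖h x t‖ₑ ^ p ∂P ∂ν :=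
        lintegral_mono fun x => aux_jensen P hp (hh.comp measurable_prodMk_left)
    _ = ∫⁻ t, ∫⁻ x, ‖h x t‖ₑ ^ p ∂ν ∂P := by
        apply lintegral_lintegral_swap
        exact (hh.enorm.pow_const p).aemeasurable
    _ ≤ ∫⁻ t, η ∂P := lintegral_mono_ae hη
    _ = η := by simp

lemma aux_mollify {p : ℝ} (hp : 1 ≤ p) {v : E → F} (hv : Measurable v) {r : ℝ}
    (hr : ∀ x, r < ‖x‖ → v x = 0) (hLp : ∫⁻ x, ‖v x‖ₑ ^ p ∂μ < ⊤)
    {κ : E → ℝ} (hκ : Measurable κ) (hκ0 : ∀ z, 0 ≤ κ z)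
    (hG : ∫⁻ x, ∫⁻ y, ‖v x - v y‖ₑ ^ p * ENNReal.ofReal (κ (x - y)) ∂μ ∂μ < ⊤)
    {η : ℝ≥0∞} (hη : 0 < η) :
    ∃ φ : E → F, ContDiff ℝ (⊤ : ℕ∞) φ ∧ HasCompactSupport φ ∧ (∀ x, r + 1 < ‖x‖ → φ x = 0) ∧
      ∫⁻ x, ‖v x - φ x‖ₑ ^ p ∂μ ≤ η ∧
      ∫⁻ x, ∫⁻ y, ‖(v x - φ x) - (v y - φ y)‖ₑ ^ p * ENNReal.ofReal (κ (x - y)) ∂μ ∂μ ≤ η := by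
  have hp0 : 0 < p := by linarith
  set g : E × E → F := fun q => (κ (q.1 - q.2)) ^ (1 / p) • (v q.1 - v q.2) with hgdef
  have hgm : Measurable g := by fun_prop
  have key : ∀ (z : E) (a : F), ‖(κ z) ^ (1 / p) • a‖ₑ ^ p = ‖a‖ₑ ^ p * ENNReal.ofReal (κ z) := by
    intro z a
    rw [enorm_smul, ENNReal.mul_rpow_of_nonneg _ _ hp0.le, mul_comm,
      Real.enorm_of_nonneg (Real.rpow_nonneg (hκ0 z) _),
      ENNReal.ofReal_rpow_of_nonneg (Real.rpow_nonneg (hκ0 z) _) hp0.le,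
      ← Real.rpow_mul (hκ0 z), one_div, inv_mul_cancel₀ hp0.ne', Real.rpow_one]
  have hgL : ∫⁻ q, ‖g q‖ₑ ^ p ∂(μ.prod μ) < ⊤ := by
    rw [lintegral_prod _ (hgm.enorm.pow_const p).aemeasurable]
    simp only [hgdef, key]
    exact hG
  have t1 := aux_translation μ hp hv hLp
  have t2 := aux_translation (μ.prod μ) hp hgm hgL
  have t2' : Tendsto (fun z : E => ∫⁻ q, ‖g q - g (q - (z, z))‖ₑ ^ p ∂(μ.prod μ)) (𝓝 0) (𝓝 0) := by
    refine t2.comp ?_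
    have : Continuous (fun z : E => (z, z)) := by fun_prop
    exact this.tendsto' 0 0 rfl
  have ev := (t1.eventually (ge_mem_nhds hη)).and (t2'.eventually (ge_mem_nhds hη))
  obtain ⟨δ0, hδ0, hball⟩ := Metric.eventually_nhds_iff_ball.1 ev
  set δ := min δ0 1 with hδ
  have hδpos : 0 < δ := lt_min hδ0 one_pos
  let b : ContDiffBump (0 : E) := ⟨δ / 2, δ, by positivity, by linarith⟩
  set ρ : E → ℝ := b.normed μ with hρ
  have hρ0 : ∀ x, 0 ≤ ρ x := b.nonneg_normed
  have hρm : Measurable ρ := b.continuous_normed.measurable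
  let P : Measure E := μ.withDensity (fun t => ENNReal.ofReal (ρ t))
  have hPp : IsProbabilityMeasure P := by
    constructor
    rw [withDensity_apply _ MeasurableSet.univ, Measure.restrict_univ,
      ← ofReal_integral_eq_lintegral_ofReal b.integrable_normed (ae_of_all _ hρ0), 
      b.integral_normed, ENNReal.ofReal_one]
  have hPint : ∀ f : E → F, ∫ t, f t ∂P = ∫ t, ρ t • f t ∂μ := by
    intro f
    rw [integral_withDensity_eq_integral_toReal_smul (by fun_prop) (by simp)]
    simp [ENNReal.toReal_ofReal (hρ0 _)]
  have hPi : ∀ f : E → F, Integrable (fun t => ρ t • f t) μ → Integrable f P := by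
    intro f hf
    rw [integrable_withDensity_iff_integrable_smul' (by fun_prop) (by simp)]
    simpa [ENNReal.toReal_ofReal (hρ0 _)] using hf
  have hPball : ∀ᵐ t ∂P, t ∈ Metric.ball (0 : E) δ := by
    rw [ae_withDensity_iff (by fun_prop)]
    refine ae_of_all _ fun t ht => ?_
    have : t ∈ Function.support ρ := by
      intro h0; apply ht; simp [h0]
    rwa [hρ, b.support_normed_eq] at this
  have hloc : LocallyIntegrable v μ := (aux_memLp μ hp hv hLp).locallyIntegrable (by simpa using hp)
  set φ : E → F := MeasureTheory.convolution ρ v (ContinuousLinearMap.lsmul ℝ ℝ) μ with hφ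
  have hφP : ∀ x, φ x = ∫ t, v (x - t) ∂P := by
    intro x
    rw [hPint]; rfl
  have hvi : ∀ x, Integrable (fun t => v (x - t)) P := by
    intro x
    apply hPi
    exact (b.hasCompactSupport_normed.convolutionExists_left (ContinuousLinearMap.lsmul ℝ ℝ)
      b.continuous_normed hloc x)
  have hvφ : ∀ x, v x - φ x = ∫ t, (v x - v (x - t)) ∂P := by
    intro x
    rw [integral_sub (integrable_const _) (hvi x), hφP]; simp
  have hvi2 : ∀ x, Integrable (fun t => v x - v (x - t)) P := fun x =>
    (integrable_const _).sub (hvi x)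
  have hzero : ∀ x, r + 1 < ‖x‖ → φ x = 0 := by
    intro x hx
    rw [hφP]
    apply integral_eq_zero_of_ae
    filter_upwards [hPball] with t ht
    apply hr
    have h1 : ‖t‖ < 1 := (mem_ball_zero_iff.1 ht).trans_le (min_le_right _ _)
    have := norm_sub_norm_le x t
    linarith
  refine ⟨φ, ?_, ?_, hzero, ?_, ?_⟩
  · exact b.hasCompactSupport_normed.contDiff_convolution_left _ b.contDiff_normed hloc
  · refine HasCompactSupport.intro (isCompact_closedBall (0 : E) (r + 1)) fun x hx => hzero x ?_
    simpa using hx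
  · simp only [hvφ]
    refine aux_average μ P hp (h := fun x t => v x - v (x - t)) ?_ ?_
    · simp only [Function.uncurry_def]; fun_prop
    · filter_upwards [hPball] with t ht
      exact (hball t (Metric.ball_subset_ball (min_le_left _ _) ht)).1
  · have heq : ∀ q : E × E, ‖(v q.1 - φ q.1) - (v q.2 - φ q.2)‖ₑ ^ p * ENNReal.ofReal (κ (q.1 - q.2))
        = ‖∫ t, (g q - g (q - (t, t))) ∂P‖ₑ ^ p := by
      intro q
      rw [← key, hvφ, hvφ, ← integral_sub (hvi2 _) (hvi2 _),
        ← integral_smul]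
      congr 3
      ext t
      simp only [hgdef, Prod.fst_sub, Prod.snd_sub, sub_sub_sub_cancel_right, ← smul_sub]
      congr 1
      abel
    have h1 : ∫⁻ q, ‖∫ t, (g q - g (q - (t, t))) ∂P‖ₑ ^ p ∂(μ.prod μ) ≤ η := by
      refine aux_average (μ.prod μ) P hp (h := fun q t => g q - g (q - (t, t))) ?_ ?_
      · simp only [Function.uncurry_def]; fun_prop
      · filter_upwards [hPball] with t ht
        exact (hball t (Metric.ball_subset_ball (min_le_left _ _) ht)).2
    simp only [← heq] at h1
    have hφm : Measurable φ := 
      (b.hasCompactSupport_normed.contDiff_convolution_left (n := 0) (ContinuousLinearMap.lsmul ℝ ℝ) b.contDiff_normed hloc).continuous.measurable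
    rw [lintegral_prod] at h1
    · exact h1
    · fun_prop
end Mollify

section Main

lemma aux_pow4 {p : ℝ} (hp : 1 ≤ p) (a b c d : ℝ≥0∞) :
    (a + b + c + d) ^ p ≤ 4 ^ p * (a ^ p + b ^ p + c ^ p + d ^ p) := by
  have hm : Monotone (fun x : ℝ≥0∞ => x ^ p) := ENNReal.monotone_rpow_of_nonneg (by linarith)
  set M := max (max a b) (max c d) with hM
  have h1 : a + b + c + d ≤ 4 * M := by
    calc a + b + c + d ≤ M + M + M + M := by gcongr <;> simp [hM]
      _ = 4 * M := by ring
  refine (hm h1).trans ?_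
  simp only [ENNReal.mul_rpow_of_nonneg _ _ (by linarith : (0:ℝ) ≤ p)]
  gcongr
  have h2 : M ^ p = max (max (a ^ p) (b ^ p)) (max (c ^ p) (d ^ p)) := by
    rw [hM, hm.map_max, hm.map_max, hm.map_max]
  rw [h2]
  refine max_le (max_le ?_ ?_) (max_le ?_ ?_)
  · exact le_add_right (le_add_right le_self_add)
  · exact le_add_right (le_add_right le_add_self)
  · exact le_add_right le_add_self
  · exact le_add_self

variable {E F : Type*} [NormedAddCommGroup E] [NormedSpace ℝ E] [FiniteDimensional ℝ E]
  [MeasurableSpace E] [BorelSpace E] (μ : Measure E) [μ.IsAddHaarMeasure]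
  [NormedAddCommGroup F] [NormedSpace ℝ F] [FiniteDimensional ℝ F] [MeasurableSpace F] [BorelSpace F]

lemma aux_add (f g : E → E → ℝ≥0∞) (hg : Measurable (Function.uncurry g)) :
    ∫⁻ x, ∫⁻ y, (f x y + g x y) ∂μ ∂μ = ∫⁻ x, ∫⁻ y, f x y ∂μ ∂μ + ∫⁻ x, ∫⁻ y, g x y ∂μ ∂μ := by
  have h1 : ∀ x, ∫⁻ y, (f x y + g x y) ∂μ = ∫⁻ y, f x y ∂μ + ∫⁻ y, g x y ∂μ := fun x =>
    lintegral_add_right _ (hg.comp measurable_prodMk_left)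
  simp only [h1]
  exact lintegral_add_right _ hg.lintegral_prod_right

lemma aux_conv (ψ h : E → ℝ≥0∞) (hψ : Measurable ψ) (hh : Measurable h) :
    ∫⁻ x, ∫⁻ y, ψ (x - y) * h y ∂μ ∂μ = (∫⁻ z, ψ z ∂μ) * ∫⁻ y, h y ∂μ := by
  rw [lintegral_lintegral_swap (by simp only [Function.uncurry_def]; fun_prop)]
  have h1 : ∀ y, ∫⁻ x, ψ (x - y) * h y ∂μ = (∫⁻ z, ψ z ∂μ) * h y := by
    intro y
    rw [lintegral_mul_const _ (by fun_prop), lintegral_sub_right_eq_self ψ y]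
  simp only [h1]
  rw [lintegral_const_mul _ hh]

lemma aux_tail (H : E → ℝ≥0∞) (hH : ∫⁻ x, H x ∂μ < ⊤) :
    Tendsto (fun N : ℕ => ∫⁻ x in (Metric.closedBall (0 : E) N)ᶜ, H x ∂μ) atTop (𝓝 0) := by
  have hmono : Monotone (fun N : ℕ => Metric.closedBall (0 : E) (N : ℝ)) := fun a b hab =>
    Metric.closedBall_subset_closedBall (by exact_mod_cast hab)
  have hU : ⋃ N : ℕ, Metric.closedBall (0 : E) (N : ℝ) = univ := Metric.iUnion_closedBall_nat 0
  have h1 := setLIntegral_iUnion_of_directed (μ := μ) H hmono.directed_le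
  rw [hU, Measure.restrict_univ] at h1
  have h2 : Tendsto (fun N : ℕ => ∫⁻ x in Metric.closedBall (0 : E) (N : ℝ), H x ∂μ) atTop
      (𝓝 (∫⁻ x, H x ∂μ)) := by
    rw [h1]
    exact tendsto_atTop_iSup fun a b hab => lintegral_mono_set (hmono hab)
  have h3 : ∀ N : ℕ, ∫⁻ x in (Metric.closedBall (0 : E) N)ᶜ, H x ∂μ
      = ∫⁻ x, H x ∂μ - ∫⁻ x in Metric.closedBall (0 : E) (N : ℝ), H x ∂μ := by
    intro N
    rw [← lintegral_add_compl (μ := μ) H (Metric.isClosed_closedBall (x := (0:E)) (ε := N)).measurableSet]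
    rw [ENNReal.add_sub_cancel_left]
    exact ((lintegral_mono' Measure.restrict_le_self le_rfl).trans_lt hH).ne
  simp only [h3]
  have := ENNReal.Tendsto.sub (tendsto_const_nhds (x := ∫⁻ x, H x ∂μ)) h2 (Or.inl hH.ne)
  simpa using this

lemma aux_cutoff (N : ℕ) (hN : 1 ≤ N) : ∃ χ : E → ℝ, Continuous χ ∧ (∀ x, ‖χ x‖ₑ ≤ 1) ∧
    (∀ x, ‖1 - χ x‖ₑ ≤ 1) ∧
    (∀ x, ‖x‖ ≤ N → χ x = 1) ∧ (∀ x, 2 * N < ‖x‖ → χ x = 0) ∧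
    ∀ x y, ‖χ x - χ y‖ₑ ≤ min 1 (‖x - y‖ₑ / N) := by
  have hN0 : (0 : ℝ) < N := by exact_mod_cast hN
  have h01 : ∀ x : E, 0 ≤ max 0 (min 1 (2 - ‖x‖ / N)) := fun x => le_max_left _ _
  have h02 : ∀ x : E, max 0 (min 1 (2 - ‖x‖ / N)) ≤ 1 := fun x => max_le zero_le_one (min_le_left _ _)
  have en : ∀ a : ℝ, |a| ≤ 1 → ‖a‖ₑ ≤ 1 := by
    intro a ha
    rw [← ofReal_norm, Real.norm_eq_abs]
    simpa using ha
  refine ⟨fun x => max 0 (min 1 (2 - ‖x‖ / N)), by fun_prop, ?_, ?_, ?_, ?_, ?_⟩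
  · intro x
    exact en _ (abs_le.2 ⟨by linarith [h01 x], h02 x⟩)
  · intro x
    exact en _ (abs_le.2 ⟨by linarith [h02 x], by linarith [h01 x]⟩)
  · intro x hx
    have : ‖x‖ / N ≤ 1 := (div_le_one hN0).2 hx
    change max 0 (min 1 (2 - ‖x‖ / N)) = 1
    rw [min_eq_left (by linarith)]; simp
  · intro x hx
    have : 2 < ‖x‖ / N := (lt_div_iff₀ hN0).2 hx
    change max 0 (min 1 (2 - ‖x‖ / N)) = 0
    rw [max_eq_left]
    exact (min_le_right _ _).trans (by linarith)
  · intro x y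
    refine le_min (en _ (abs_le.2 ⟨by linarith [h01 x, h02 y], by linarith [h01 y, h02 x]⟩)) ?_
    have h1 : |max 0 (min 1 (2 - ‖x‖ / N)) - max 0 (min 1 (2 - ‖y‖ / N))| ≤ ‖x - y‖ / N := by
      calc _ ≤ |min 1 (2 - ‖x‖ / N) - min 1 (2 - ‖y‖ / N)| := by
              have := abs_max_sub_max_le_max 0 (min 1 (2 - ‖x‖ / N)) 0 (min 1 (2 - ‖y‖ / N))
              simpa using this
        _ ≤ |(2 - ‖x‖ / N) - (2 - ‖y‖ / N)| := by
              have := abs_min_sub_min_le_max 1 (2 - ‖x‖ / N) 1 (2 - ‖y‖ / N)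
              simpa using this
        _ = |‖x‖ - ‖y‖| / N := by
              rw [show (2 - ‖x‖ / N) - (2 - ‖y‖ / N) = - ((‖x‖ - ‖y‖) / N) by ring, abs_neg, abs_div,
                abs_of_pos hN0]
        _ ≤ _ := by gcongr; exact abs_norm_sub_norm_le x y
    rw [← ofReal_norm, Real.norm_eq_abs]
    refine (ENNReal.ofReal_le_ofReal h1).trans ?_
    rw [ENNReal.ofReal_div_of_pos hN0, ofReal_norm, ENNReal.ofReal_natCast]

lemma aux_kernel_tendsto {p : ℝ} (hp : 1 ≤ p) {κ : E → ℝ} (hκ : Measurable κ)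
    (hK : ∫⁻ z, (min 1 ‖z‖ₑ) ^ p * ENNReal.ofReal (κ z) ∂μ < ⊤) :
    Tendsto (fun N : ℕ => ∫⁻ z, (min 1 (‖z‖ₑ / N)) ^ p * ENNReal.ofReal (κ z) ∂μ) atTop (𝓝 0) := by
  have hp0 : 0 < p := by linarith
  have := tendsto_lintegral_filter_of_dominated_convergence (μ := μ) (l := atTop)
    (F := fun (N : ℕ) z => (min 1 (‖z‖ₑ / N)) ^ p * ENNReal.ofReal (κ z)) (f := fun _ => 0)
    (fun z => (min 1 ‖z‖ₑ) ^ p * ENNReal.ofReal (κ z)) ?_ ?_ hK.ne ?_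
  · simpa using this
  · exact Eventually.of_forall fun N => by fun_prop
  · filter_upwards [eventually_ge_atTop 1] with N hN
    refine ae_of_all _ fun z => ?_
    gcongr
    refine ENNReal.div_le_of_le_mul ?_
    exact le_mul_of_one_le_right (zero_le) (by exact_mod_cast hN)
  · refine ae_of_all _ fun z => ?_
    have h1 : Tendsto (fun N : ℕ => ‖z‖ₑ / (N : ℝ≥0∞)) atTop (𝓝 0) := 
      ENNReal.Tendsto.const_div ENNReal.tendsto_nat_nhds_top (Or.inr enorm_ne_top) |>.trans (by simp)
    have h2 : Tendsto (fun N : ℕ => min 1 (‖z‖ₑ / (N : ℝ≥0∞))) atTop (𝓝 0) := by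
      have := (tendsto_const_nhds (x := (1 : ℝ≥0∞))).min h1
      simpa using this
    have h3 := h2.ennrpow_const p
    rw [ENNReal.zero_rpow_of_pos hp0] at h3
    have h4 := ENNReal.Tendsto.mul_const (b := ENNReal.ofReal (κ z)) h3 (Or.inr (by simp))
    simpa using h4

lemma aux_main {p : ℝ} (hp : 1 ≤ p) {κ : E → ℝ} (hκ : Measurable κ) (hκ0 : ∀ z, 0 ≤ κ z)
    (hK : ∫⁻ z, (min 1 ‖z‖ₑ) ^ p * ENNReal.ofReal (κ z) ∂μ < ⊤)
    (R : E → E → F →L[ℝ] F) (hR1 : ∀ x y w, ‖R x y w‖ₑ = ‖w‖ₑ)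
    (hR2 : ∀ r : ℝ, ∃ C : ℝ≥0∞, C ≠ ⊤ ∧ ∀ x y w, ‖y‖ ≤ r →
      ‖w - R x y w‖ₑ ≤ C * min 1 ‖x - y‖ₑ * ‖w‖ₑ)
    {u : E → F} (hu : Measurable u) (huLp : ∫⁻ x, ‖u x‖ₑ ^ p ∂μ < ⊤)
    (huG : ∫⁻ x, ∫⁻ y, ‖u x - R x y (u y)‖ₑ ^ p * ENNReal.ofReal (κ (x - y)) ∂μ ∂μ < ⊤)
    {ε : ℝ≥0∞} (hε : 0 < ε) (hεt : ε ≠ ⊤) :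
    ∃ φ : E → F, ContDiff ℝ (⊤ : ℕ∞) φ ∧ HasCompactSupport φ ∧
      ∫⁻ x, ‖u x - φ x‖ₑ ^ p ∂μ + 
      ∫⁻ x, ∫⁻ y, ‖(u x - φ x) - R x y (u y - φ y)‖ₑ ^ p * ENNReal.ofReal (κ (x - y)) ∂μ ∂μ < ε := by
  have hp0 : 0 < p := by linarith
  set A : ℝ≥0∞ := 4 ^ p with hA
  have hA0 : A ≠ 0 := by simp [hA]
  have hAt : A ≠ ⊤ := ENNReal.rpow_ne_top_of_nonneg hp0.le (by simp)
  set η : ℝ≥0∞ := ε / 2 / (A * 6) with hηdef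
  have hη : 0 < η := by
    refine ENNReal.div_pos (ENNReal.div_pos hε.ne' (by simp)).ne' (ENNReal.mul_ne_top hAt (by simp))
  have hηε : A * 6 * η < ε := lt_of_le_of_lt ENNReal.mul_div_le (ENNReal.half_lt_self hε.ne' hεt)
  -- choice of the truncation radius
  have T1 := aux_tail μ _ huLp
  have T2 := aux_tail μ _ huG
  have T3 := ENNReal.Tendsto.mul_const (b := ∫⁻ x, ‖u x‖ₑ ^ p ∂μ) (aux_kernel_tendsto μ hp hκ hK)
    (Or.inr huLp.ne)
  rw [zero_mul] at T3
  obtain ⟨N, hN1, hN2, hN3, hN4⟩ := ((eventually_ge_atTop 1).and ((T1.eventually (ge_mem_nhds hη)).and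
    ((T2.eventually (ge_mem_nhds hη)).and (T3.eventually (ge_mem_nhds hη))))).exists
  obtain ⟨χ, hχc, hχ1, hχ1', hχin, hχout, hχL⟩ := aux_cutoff (E := E) N hN1
  obtain ⟨C, hC, hCR⟩ := hR2 (2 * N + 1)
  have hχm : Measurable χ := hχc.measurable
  set S : Set E := (Metric.closedBall (0 : E) N)ᶜ with hS
  have hSm : MeasurableSet S := Metric.isClosed_closedBall.measurableSet.compl
  set v : E → F := fun x => χ x • u x with hv
  have hvm : Measurable v := by fun_prop
  have hvu : ∀ x, ‖v x‖ₑ ≤ ‖u x‖ₑ := fun x => by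
    rw [hv]; simp only [enorm_smul]
    exact mul_le_of_le_one_left zero_le (hχ1 x)
  have hv0 : ∀ x, 2 * N < ‖x‖ → v x = 0 := fun x hx => by simp [hv, hχout x hx]
  have hvLp : ∫⁻ x, ‖v x‖ₑ ^ p ∂μ < ⊤ := by
    refine (lintegral_mono fun x => ?_).trans_lt huLp
    exact ENNReal.rpow_le_rpow (hvu x) hp0.le
  -- transport error estimate
  have hCerr : ∀ (w : E → F), (∀ x, 2 * N + 1 < ‖x‖ → w x = 0) → ∀ x y,
      ‖w y - R x y (w y)‖ₑ ≤ C * min 1 ‖x - y‖ₑ * ‖w y‖ₑ := by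
    intro w hw x y
    by_cases hy : ‖y‖ ≤ 2 * N + 1
    · exact hCR x y _ hy
    · simp [hw y (not_le.1 hy)]
  set K : ℝ≥0∞ := ∫⁻ z, (min 1 ‖z‖ₑ) ^ p * ENNReal.ofReal (κ z) ∂μ with hKdef
  have hCp : C ^ p ≠ ⊤ := ENNReal.rpow_ne_top_of_nonneg hp0.le hC
  have hCK : C ^ p * K ≠ ⊤ := ENNReal.mul_ne_top hCp hK.ne
  have hconvC : ∀ w : E → F, Measurable w →
      ∫⁻ x, ∫⁻ y, C ^ p * ((min 1 ‖x - y‖ₑ) ^ p * ENNReal.ofReal (κ (x - y)) * ‖w y‖ₑ ^ p) ∂μ ∂μ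
        = C ^ p * K * ∫⁻ y, ‖w y‖ₑ ^ p ∂μ := by
    intro w hw
    simp_rw [lintegral_const_mul' _ _ hCp]
    rw [aux_conv μ (fun z => (min 1 ‖z‖ₑ) ^ p * ENNReal.ofReal (κ z)) (fun y => ‖w y‖ₑ ^ p)
      (by fun_prop) (by fun_prop), mul_assoc]
  have hconvN : 
      ∫⁻ x, ∫⁻ y, (min 1 (‖x - y‖ₑ / N)) ^ p * ENNReal.ofReal (κ (x - y)) * ‖u y‖ₑ ^ p ∂μ ∂μ ≤ η := by
    rw [aux_conv μ (fun z => (min 1 (‖z‖ₑ / N)) ^ p * ENNReal.ofReal (κ z)) (fun y => ‖u y‖ₑ ^ p)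
      (by fun_prop) (by fun_prop)]
    exact hN4
  -- the truncated map has finite ordinary Gagliardo seminorm
  have hvG : ∫⁻ x, ∫⁻ y, ‖v x - v y‖ₑ ^ p * ENNReal.ofReal (κ (x - y)) ∂μ ∂μ < ⊤ := by
    have hpt : ∀ x y, ‖v x - v y‖ₑ ^ p * ENNReal.ofReal (κ (x - y)) ≤
        A * ((‖u x - R x y (u y)‖ₑ ^ p * ENNReal.ofReal (κ (x - y))
          + (min 1 (‖x - y‖ₑ / N)) ^ p * ENNReal.ofReal (κ (x - y)) * ‖u y‖ₑ ^ p)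
          + C ^ p * ((min 1 ‖x - y‖ₑ) ^ p * ENNReal.ofReal (κ (x - y)) * ‖v y‖ₑ ^ p)) := by
      intro x y
      have e1 : v x - v y = χ x • (u x - R x y (u y)) + (χ x - χ y) • R x y (u y)
          - (v y - R x y (v y)) := by
        simp only [hv, map_smul, smul_sub, sub_smul]; abel
      have e2 : ‖v x - v y‖ₑ ≤ ‖u x - R x y (u y)‖ₑ + min 1 (‖x - y‖ₑ / N) * ‖u y‖ₑ
          + C * min 1 ‖x - y‖ₑ * ‖v y‖ₑ + 0 := by
        rw [e1, add_zero]
        refine enorm_sub_le.trans (add_le_add ((enorm_add_le _ _).trans (add_le_add ?_ ?_)) ?_)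
        · rw [enorm_smul]; exact mul_le_of_le_one_left zero_le (hχ1 x)
        · rw [enorm_smul, hR1]; gcongr; exact hχL x y
        · exact hCerr v (fun x hx => hv0 x (by linarith)) x y
      calc _ ≤ (‖u x - R x y (u y)‖ₑ + min 1 (‖x - y‖ₑ / N) * ‖u y‖ₑ
          + C * min 1 ‖x - y‖ₑ * ‖v y‖ₑ + 0) ^ p * ENNReal.ofReal (κ (x - y)) := by gcongr
        _ ≤ A * (‖u x - R x y (u y)‖ₑ ^ p + (min 1 (‖x - y‖ₑ / N) * ‖u y‖ₑ) ^ p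
          + (C * min 1 ‖x - y‖ₑ * ‖v y‖ₑ) ^ p + 0 ^ p) * ENNReal.ofReal (κ (x - y)) := by
            gcongr; exact aux_pow4 hp _ _ _ _
        _ = _ := by
            simp only [ENNReal.mul_rpow_of_nonneg _ _ hp0.le, ENNReal.zero_rpow_of_pos hp0]
            ring
    refine (lintegral_mono fun x => lintegral_mono fun y => hpt x y).trans_lt ?_
    simp_rw [lintegral_const_mul' _ _ hAt]
    rw [aux_add, aux_add, hconvC v hvm]
    · refine ENNReal.mul_lt_top hAt.lt_top (ENNReal.add_lt_top.2 ⟨ENNReal.add_lt_top.2 ⟨huG, ?_⟩, ?_⟩)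
      · refine hconvN.trans_lt ?_
        exact (ENNReal.div_lt_top (ENNReal.div_lt_top hεt (by simp)).ne (by simp [hA0]))
      · exact ENNReal.mul_lt_top hCK.lt_top hvLp
    · simp only [Function.uncurry_def]; fun_prop
    · simp only [Function.uncurry_def]; fun_prop
  -- mollification
  set η' : ℝ≥0∞ := min η (η / (C ^ p * K)) with hη'
  have hη'0 : 0 < η' := lt_min hη (ENNReal.div_pos hη.ne' hCK)
  obtain ⟨φ, hφs, hφc, hφ0, hφL, hφG⟩ := aux_mollify μ hp hvm hv0 hvLp hκ hκ0 hvG hη'0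
  refine ⟨φ, hφs, hφc, ?_⟩
  have hφm : Measurable φ := hφs.continuous.measurable
  set e : E → F := fun x => v x - φ x with he
  have hem : Measurable e := by fun_prop
  have he0 : ∀ x, 2 * N + 1 < ‖x‖ → e x = 0 := fun x hx => by
    simp [he, hφ0 x hx, hv0 x (by linarith)]
  have hSin : ∀ x (a : ℝ≥0∞), ‖1 - χ x‖ₑ ^ p * a ≤ S.indicator (fun _ => a) x := by
    intro x a
    by_cases hx : x ∈ S
    · rw [indicator_of_mem hx]
      exact mul_le_of_le_one_left zero_le (ENNReal.rpow_le_one (hχ1' x) hp0.le)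
    · have : ‖x‖ ≤ N := by simpa [hS] using hx
      simp [hχin x this, hp0]
  have hue : ∀ x, u x - φ x = (1 - χ x) • u x + e x := fun x => by
    simp only [he, hv, sub_smul, one_smul]; abel
  have L1 : ∫⁻ x, ‖u x - φ x‖ₑ ^ p ∂μ ≤ A * (η + η) := by
    have hpt : ∀ x, ‖u x - φ x‖ₑ ^ p ≤ A * (S.indicator (fun x => ‖u x‖ₑ ^ p) x + ‖e x‖ₑ ^ p) := by
      intro x
      calc ‖u x - φ x‖ₑ ^ p ≤ (‖1 - χ x‖ₑ * ‖u x‖ₑ + ‖e x‖ₑ + 0 + 0) ^ p := by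
            gcongr
            rw [hue, add_zero, add_zero]
            refine (enorm_add_le _ _).trans ?_
            rw [enorm_smul]
        _ ≤ A * ((‖1 - χ x‖ₑ * ‖u x‖ₑ) ^ p + ‖e x‖ₑ ^ p + 0 ^ p + 0 ^ p) := aux_pow4 hp _ _ _ _
        _ = A * (‖1 - χ x‖ₑ ^ p * ‖u x‖ₑ ^ p + ‖e x‖ₑ ^ p) := by
            simp only [ENNReal.mul_rpow_of_nonneg _ _ hp0.le, ENNReal.zero_rpow_of_pos hp0, add_zero]
        _ ≤ _ := by
            gcongr
            exact hSin x _
    refine (lintegral_mono hpt).trans ?_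
    rw [lintegral_const_mul' _ _ hAt, lintegral_add_right _ (by fun_prop), lintegral_indicator hSm]
    gcongr
    exact hφL.trans (min_le_left _ _)
  have L2 : ∫⁻ x, ∫⁻ y, ‖(u x - φ x) - R x y (u y - φ y)‖ₑ ^ p * ENNReal.ofReal (κ (x - y)) ∂μ ∂μ
      ≤ A * (η + η + η + η) := by
    have hpt : ∀ x y, ‖(u x - φ x) - R x y (u y - φ y)‖ₑ ^ p * ENNReal.ofReal (κ (x - y)) ≤
        A * (((S.indicator (fun x => ‖u x - R x y (u y)‖ₑ ^ p * ENNReal.ofReal (κ (x - y))) x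
          + (min 1 (‖x - y‖ₑ / N)) ^ p * ENNReal.ofReal (κ (x - y)) * ‖u y‖ₑ ^ p)
          + ‖e x - e y‖ₑ ^ p * ENNReal.ofReal (κ (x - y)))
          + C ^ p * ((min 1 ‖x - y‖ₑ) ^ p * ENNReal.ofReal (κ (x - y)) * ‖e y‖ₑ ^ p)) := by
      intro x y
      have e1 : (u x - φ x) - R x y (u y - φ y) = (1 - χ x) • (u x - R x y (u y)) 
          - (χ x - χ y) • R x y (u y) + (e x - e y) + (e y - R x y (e y)) := by
        rw [hue, hue, map_add, map_smul]
        simp only [ smul_sub, sub_smul, one_smul]; abel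
      have e2 : ‖(u x - φ x) - R x y (u y - φ y)‖ₑ ≤ ‖1 - χ x‖ₑ * ‖u x - R x y (u y)‖ₑ 
          + min 1 (‖x - y‖ₑ / N) * ‖u y‖ₑ + ‖e x - e y‖ₑ
          + C * min 1 ‖x - y‖ₑ * ‖e y‖ₑ := by
        rw [e1]
        refine (enorm_add_le _ _).trans (add_le_add ((enorm_add_le _ _).trans (add_le_add 
          (enorm_sub_le.trans (add_le_add ?_ ?_)) le_rfl)) ?_)
        · rw [enorm_smul]
        · rw [enorm_smul, hR1]; gcongr; exact hχL x y
        · exact hCerr e he0 x y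
      calc _ ≤ (‖1 - χ x‖ₑ * ‖u x - R x y (u y)‖ₑ 
          + min 1 (‖x - y‖ₑ / N) * ‖u y‖ₑ + ‖e x - e y‖ₑ
          + C * min 1 ‖x - y‖ₑ * ‖e y‖ₑ) ^ p * ENNReal.ofReal (κ (x - y)) := by gcongr
        _ ≤ A * ((‖1 - χ x‖ₑ * ‖u x - R x y (u y)‖ₑ) ^ p 
          + (min 1 (‖x - y‖ₑ / N) * ‖u y‖ₑ) ^ p + ‖e x - e y‖ₑ ^ p
          + (C * min 1 ‖x - y‖ₑ * ‖e y‖ₑ) ^ p) * ENNReal.ofReal (κ (x - y)) := by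
            gcongr; exact aux_pow4 hp _ _ _ _
        _ = A * (((‖1 - χ x‖ₑ ^ p * (‖u x - R x y (u y)‖ₑ ^ p * ENNReal.ofReal (κ (x - y)))
          + (min 1 (‖x - y‖ₑ / N)) ^ p * ENNReal.ofReal (κ (x - y)) * ‖u y‖ₑ ^ p)
          + ‖e x - e y‖ₑ ^ p * ENNReal.ofReal (κ (x - y)))
          + C ^ p * ((min 1 ‖x - y‖ₑ) ^ p * ENNReal.ofReal (κ (x - y)) * ‖e y‖ₑ ^ p)) := by
            simp only [ENNReal.mul_rpow_of_nonneg _ _ hp0.le]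
            ring
        _ ≤ _ := by
            gcongr
            refine (hSin x _).trans (le_of_eq ?_)
            by_cases hx : x ∈ S <;> simp [hx]
    refine (lintegral_mono fun x => lintegral_mono fun y => hpt x y).trans ?_
    simp_rw [lintegral_const_mul' _ _ hAt]
    rw [aux_add, aux_add, aux_add, hconvC e hem]
    · gcongr
      · have : ∀ x, ∫⁻ y, S.indicator (fun x => ‖u x - R x y (u y)‖ₑ ^ p * ENNReal.ofReal (κ (x - y))) x ∂μ
            = S.indicator (fun x => ∫⁻ y, ‖u x - R x y (u y)‖ₑ ^ p * ENNReal.ofReal (κ (x - y)) ∂μ) x := by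
          intro x
          by_cases hx : x ∈ S <;> simp [hx]
        simp_rw [this]
        rw [lintegral_indicator hSm]
        exact hN3
      · exact hφG.trans (min_le_left _ _)
      · calc _ ≤ C ^ p * K * (η / (C ^ p * K)) := by
              gcongr; exact hφL.trans (min_le_right _ _)
          _ ≤ η := ENNReal.mul_div_le
    all_goals simp only [Function.uncurry_def]; fun_prop
  calc _ ≤ A * (η + η) + A * (η + η + η + η) := add_le_add L1 L2
    _ = A * 6 * η := by ring
    _ < ε := hηε

end Main

/-- Density of smooth compactly supported maps in the fractional
gauge-covariant Sobolev space `W^{s,p}_{Γ∥}(ℝⁿ, F)`. -/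
theorem smooth_compactly_supported_dense_fractional
    {F : Type*} [NormedAddCommGroup F] [InnerProductSpace ℝ F] [FiniteDimensional ℝ F] [MeasurableSpace F] [BorelSpace F]
    (n : ℕ) (hn : 1 ≤ n) (s p : ℝ) (hs0 : 0 < s) (hs1 : s < 1) (hp : 1 ≤ p)
    -- the continuous connection form Γ∥ on ℝⁿ with skew-adjoint values
    (Γ : EuclideanSpace ℝ (Fin n) → EuclideanSpace ℝ (Fin n) →L[ℝ] F →L[ℝ] F)
    (hΓcont : Continuous Γ)
    (hskew : ∀ (x v : EuclideanSpace ℝ (Fin n)) (u w : F),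
      ⟪(Γ x v) u, w⟫ = -⟪u, (Γ x v) w⟫)
    -- Rt x y is the parallel transport R^{Γ∥}(x,y) along the affine segment
    (Rt : EuclideanSpace ℝ (Fin n) → EuclideanSpace ℝ (Fin n) → F →L[ℝ] F)
    (hRt : ∀ x y : EuclideanSpace ℝ (Fin n), ∃ P : ℝ → F →L[ℝ] F,
      P 1 = ContinuousLinearMap.id ℝ F ∧
      (∀ t ∈ Icc (0:ℝ) 1, HasDerivWithinAt P
        (-((Γ ((1 - t) • x + t • y)) (y - x)).comp (P t)) (Icc (0:ℝ) 1) t) ∧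
      Rt x y = P 0)
    -- u belongs to W^{s,p}_{Γ∥}(ℝⁿ, F)
    (u : EuclideanSpace ℝ (Fin n) → F) (hu : Measurable u)
    (huLp : (∫⁻ x : EuclideanSpace ℝ (Fin n), ENNReal.ofReal (‖u x‖ ^ p)) < ⊤)
    (huGag : (∫⁻ x : EuclideanSpace ℝ (Fin n), ∫⁻ y : EuclideanSpace ℝ (Fin n),
        ENNReal.ofReal (‖u x - (Rt x y) (u y)‖ ^ p / ‖x - y‖ ^ ((n : ℝ) + s * p))) < ⊤) :
    ∀ ε : ℝ, 0 < ε →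
      ∃ φ : EuclideanSpace ℝ (Fin n) → F, ContDiff ℝ (⊤ : ℕ∞) φ ∧ HasCompactSupport φ ∧
        (∫⁻ x : EuclideanSpace ℝ (Fin n), ENNReal.ofReal (‖u x - φ x‖ ^ p))
          + (∫⁻ x : EuclideanSpace ℝ (Fin n), ∫⁻ y : EuclideanSpace ℝ (Fin n),
              ENNReal.ofReal (‖(u x - φ x) - (Rt x y) (u y - φ y)‖ ^ p
                / ‖x - y‖ ^ ((n : ℝ) + s * p)))
          < ENNReal.ofReal ε := by
  intro ε hε
  have hp0 : 0 < p := by linarith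
  have : Nonempty (Fin n) := ⟨⟨0, hn⟩⟩
  have c1 : ∀ a : F, ENNReal.ofReal (‖a‖ ^ p) = ‖a‖ₑ ^ p := fun a => by
    rw [← ENNReal.ofReal_rpow_of_nonneg (norm_nonneg _) hp0.le, ofReal_norm]
  have c2 : ∀ (a : F) (z : EuclideanSpace ℝ (Fin n)),
      ENNReal.ofReal (‖a‖ ^ p / ‖z‖ ^ ((n : ℝ) + s * p)) =
      ‖a‖ₑ ^ p * ENNReal.ofReal ((‖z‖ ^ ((n : ℝ) + s * p))⁻¹) := fun a z => by
    rw [div_eq_mul_inv, ENNReal.ofReal_mul (by positivity), c1]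
  simp only [c1, c2] at huLp huGag ⊢
  have hT := fun x y w => aux_transport Γ hskew Rt hRt x y w
  have hK := aux_kernel (E := EuclideanSpace ℝ (Fin n)) volume s p hs0 hs1 hp
  rw [finrank_euclideanSpace_fin] at hK
  refine aux_main volume hp (κ := fun z => (‖z‖ ^ ((n : ℝ) + s * p))⁻¹) (by fun_prop)
    (fun z => by positivity) hK Rt ?_ ?_ hu huLp huGag (by simpa using hε) (by simp)
  · intro x y w
    rw [← ofReal_norm, (hT x y w).1, ofReal_norm]
  · intro r
    obtain ⟨M, hM⟩ := (isCompact_closedBall (0 : EuclideanSpace ℝ (Fin n)) (r + 1)).exists_bound_of_continuousOn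
      (f := Γ) hΓcont.continuousOn
    refine ⟨ENNReal.ofReal (max 2 M), by simp, fun x y w hy => ?_⟩
    have h1 : ‖w - Rt x y w‖ ≤ max 2 M * min 1 ‖x - y‖ * ‖w‖ := by
      rcases le_total ‖x - y‖ 1 with hxy | hxy
      · rw [min_eq_right hxy]
        refine ((hT x y w).2 M ?_).trans ?_
        · intro t ht
          apply hM
          rw [mem_closedBall_zero_iff]
          have : (1 - t) • x + t • y = y + (1 - t) • (x - y) := by
            simp only [smul_sub, sub_smul, one_smul]; abel
          rw [this]
          refine (norm_add_le _ _).trans (add_le_add hy ?_)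
          rw [norm_smul, Real.norm_of_nonneg (by linarith [ht.2])]
          exact mul_le_one₀ (by linarith [ht.1]) (norm_nonneg _) hxy
        · gcongr; exact le_max_right _ _
      · rw [min_eq_left hxy, mul_one]
        calc _ ≤ ‖w‖ + ‖Rt x y w‖ := norm_sub_le _ _
          _ = 2 * ‖w‖ := by rw [(hT x y w).1]; ring
          _ ≤ _ := by gcongr; exact le_max_left _ _
    have h2 := ENNReal.ofReal_le_ofReal h1
    rwa [ENNReal.ofReal_mul (by positivity), ENNReal.ofReal_mul (by positivity), ENNReal.ofReal_min,
      ENNReal.ofReal_one, ofReal_norm, ofReal_norm, ofReal_norm] at h2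
end
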